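/- arXiv:1503.01069 — 3 statements merged into one kernel-verified Lean document; each statement's English description precedes it below -/
import Mathlib

section
/- Let Γ be a connected weighted graph on {1,…,N} whose black edges carry fixed positive weights and which has exactly two red edges, one joining vertices i and j and one joining vertices k and l, carrying weights −x and −y respectively. Set U = {i,j}, W = {k,l}. Then Δ = −( Σ_{F ∈ F²_{U,W}} ε(F) π(F) )², where F²_{U,W} is the set of spanning 2-forests of Γ (spanning forests with exactly two connected components) in which each component contains exactly one vertex of U and exactly one vertex of W, π(F) is the product of the weights of the edges of F (no such forest can contain either red edge, so π(F) is a product of black weights), and ε(F) = +1 if i and k lie in the same component of F and ε(F) = −1 otherwise. -/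
open Finset
open scoped Classical

/-- The graph Laplacian of a weighted graph on `{1,…,N}`. -/
noncomputable def lapl {N : ℕ} (γ : Fin N → Fin N → ℝ) : Matrix (Fin N) (Fin N) ℝ :=
  Matrix.of fun i j =>
    if i = j then -(∑ k ∈ univ.filter (fun k => k ≠ i), γ i k) else γ i j

/-- The simple graph on `Fin N` whose edges are the (ordered) pairs in `T`. -/
def edgeGraph {N : ℕ} (T : Finset (Fin N × Fin N)) : SimpleGraph (Fin N) :=
  SimpleGraph.fromRel fun a b => (a, b) ∈ T

/-- The product of the weights of the edges in `T`. -/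
noncomputable def prodWeight {N : ℕ} (γ : Fin N → Fin N → ℝ)
    (T : Finset (Fin N × Fin N)) : ℝ :=
  ∏ p ∈ T, γ p.1 p.2

/-- The black edges: the (ordered) pairs carrying a nonzero (positive) weight. -/
noncomputable def blackE {N : ℕ} (γ : Fin N → Fin N → ℝ) : Finset (Fin N × Fin N) :=
  univ.filter fun p => p.1 < p.2 ∧ γ p.1 p.2 ≠ 0

/-- The ordered pair representing the edge `{i, j}`. -/
def redPair {N : ℕ} (i j : Fin N) : Fin N × Fin N := (min i j, max i j)

/-- Spanning trees of the graph `Γ` whose edges are the black edges of `γ`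
together with the two red edges `{i,j}` and `{k,l}`. -/
noncomputable def spTrees {N : ℕ} (γ : Fin N → Fin N → ℝ) (i j k l : Fin N) :
    Finset (Finset (Fin N × Fin N)) :=
  univ.filter fun T =>
    T ⊆ blackE γ ∪ {redPair i j, redPair k l} ∧ (edgeGraph T).IsTree

/-- The coefficient `A_{b₁b₂}`: the sum, over all spanning trees of `Γ` whose
set of red edges is exactly the one prescribed by `(b₁, b₂)`, of the product of
the black edge weights of the tree. -/
noncomputable def coeffA {N : ℕ} (γ : Fin N → Fin N → ℝ) (i j k l : Fin N)
    (b1 b2 : Bool) : ℝ :=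
  ∑ T ∈ (spTrees γ i j k l).filter
      (fun T => (redPair i j ∈ T ↔ b1 = true) ∧ (redPair k l ∈ T ↔ b2 = true)),
    prodWeight γ (T \ {redPair i j, redPair k l})

/-- The discriminant `Δ = A₁₁A₀₀ − A₀₁A₁₀` of the crossing polynomial
`M(Γ) = A₁₁xy − A₁₀x − A₀₁y + A₀₀`. -/
noncomputable def crossDisc {N : ℕ} (γ : Fin N → Fin N → ℝ) (i j k l : Fin N) : ℝ :=
  coeffA γ i j k l true true * coeffA γ i j k l false false -
    coeffA γ i j k l false true * coeffA γ i j k l true false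

/-- Spanning 2-forests of `Γ` in which each of the two components contains
exactly one vertex of `{i,j}` and exactly one vertex of `{k,l}` (such a forest
contains no red edge, hence consists of black edges). -/
noncomputable def twoForests {N : ℕ} (γ : Fin N → Fin N → ℝ) (i j k l : Fin N) :
    Finset (Finset (Fin N × Fin N)) :=
  univ.filter fun F => F ⊆ blackE γ ∧ (edgeGraph F).IsAcyclic ∧
    Nat.card (edgeGraph F).ConnectedComponent = 2 ∧
    ¬ (edgeGraph F).Reachable i j ∧ ¬ (edgeGraph F).Reachable k l

section Helpers
open scoped Matrix

/-- Weighted sum of rank-one matrices. -/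
noncomputable def gram {N : ℕ} {ι : Type*} (E : Finset ι) (w : ι → ℝ)
    (U V : ι → Fin N → ℝ) : Matrix (Fin N) (Fin N) ℝ :=
  ∑ t ∈ E, w t • Matrix.vecMulVec (U t) (V t)

theorem gram_apply {N : ℕ} {ι : Type*} (E : Finset ι) (w : ι → ℝ)
    (U V : ι → Fin N → ℝ) (a b : Fin N) :
    gram E w U V a b = ∑ t ∈ E, w t * (U t a * V t b) := by
  simp [gram, Matrix.sum_apply, Matrix.vecMulVec_apply]

theorem gram_congr {N : ℕ} {ι : Type*} (E : Finset ι) (w w' : ι → ℝ)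
    (U V U' V' : ι → Fin N → ℝ) (hw : ∀ t ∈ E, w t = w' t) (hU : ∀ t ∈ E, U t = U' t)
    (hV : ∀ t ∈ E, V t = V' t) : gram E w U V = gram E w' U' V' := by
  refine Finset.sum_congr rfl fun t ht => ?_
  rw [hw t ht, hU t ht, hV t ht]

theorem gram_insert {N : ℕ} {ι : Type*} [DecidableEq ι] (E : Finset ι) (w : ι → ℝ)
    (U V : ι → Fin N → ℝ) (t : ι) (ht : t ∉ E) :
    gram (insert t E) w U V = gram E w U V + w t • Matrix.vecMulVec (U t) (V t) := by
  rw [gram, Finset.sum_insert ht, add_comm]; rfl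

theorem det_gram_expand {N : ℕ} {ι : Type*} (E : Finset ι) (w : ι → ℝ)
    (U V : ι → Fin N → ℝ) :
    (gram E w U V).det = ∑ f ∈ Fintype.piFinset (fun _ : Fin N => E),
      (∏ x, w (f x)) * ((∏ x, U (f x) x) * Matrix.det (Matrix.of fun x => V (f x))) := by
  have h1 : gram E w U V = Matrix.of (fun x => ∑ t ∈ E, (w t * U t x) • V t) := by
    ext a b
    rw [gram_apply]
    simp [Finset.sum_apply, mul_assoc]
  rw [h1]
  have h2 := (Matrix.detRowAlternating (n := Fin N) (R := ℝ)).toMultilinearMap.map_sum_finset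
    (fun x t => (w t * U t x) • V t) (fun _ => E)
  refine Eq.trans h2 (Finset.sum_congr rfl fun f _ => ?_)
  have h3 := (Matrix.detRowAlternating (n := Fin N) (R := ℝ)).toMultilinearMap.map_smul_univ
    (fun x => w (f x) * U (f x) x) (fun x => V (f x))
  refine Eq.trans h3 ?_
  rw [Finset.prod_mul_distrib, smul_eq_mul, mul_assoc]
  rfl

theorem cauchy_binet {N : ℕ} {ι : Type*} (E : Finset ι) (w : ι → ℝ)
    (U V : ι → Fin N → ℝ) :
    (gram E w U V).det = ∑ T ∈ E.powersetCard N,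
      (∏ t ∈ T, w t) * (gram T (fun _ => 1) U V).det := by
  have hzero : ∀ f : Fin N → ι, ¬ Function.Injective f →
      Matrix.det (Matrix.of fun x => V (f x)) = 0 := by
    intro f hf
    simp only [Function.Injective, not_forall] at hf
    obtain ⟨a, b, hab, hne⟩ := hf
    exact Matrix.det_zero_of_row_eq hne (by ext; simp [hab])
  have key : ∀ (E : Finset ι) (w : ι → ℝ), (gram E w U V).det =
      ∑ f ∈ (Fintype.piFinset (fun _ : Fin N => E)).filter Function.Injective,
      (∏ x, w (f x)) * ((∏ x, U (f x) x) * Matrix.det (Matrix.of fun x => V (f x))) := by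
    intro E w
    rw [det_gram_expand, Finset.sum_filter_of_ne]
    intro f _ hf
    by_contra h
    exact hf (by rw [hzero f h]; simp)
  rw [key E w]
  rw [← Finset.sum_fiberwise_of_maps_to (t := E.powersetCard N)
    (g := fun f : Fin N → ι => Finset.univ.image f)]
  · refine Finset.sum_congr rfl fun T hT => ?_
    rw [key T, Finset.mul_sum]
    rw [Finset.mem_powersetCard] at hT
    refine Finset.sum_congr ?_ ?_
    · ext f
      simp only [Finset.mem_filter, Fintype.mem_piFinset]
      constructor
      · rintro ⟨⟨h1, h2⟩, h3⟩
        refine ⟨fun a => ?_, h2⟩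
        rw [← h3]; exact Finset.mem_image_of_mem _ (Finset.mem_univ _)
      · rintro ⟨h1, h2⟩
        refine ⟨⟨fun a => hT.1 (h1 a), h2⟩, ?_⟩
        apply Finset.eq_of_subset_of_card_le
        · intro t ht
          obtain ⟨a, _, rfl⟩ := Finset.mem_image.1 ht
          exact h1 a
        · rw [Finset.card_image_of_injective _ h2, hT.2]; simp
    · intro f hf
      simp only [Finset.mem_filter, Fintype.mem_piFinset] at hf
      have him : Finset.univ.image f = T := by
        apply Finset.eq_of_subset_of_card_le
        · intro t ht
          obtain ⟨a, _, rfl⟩ := Finset.mem_image.1 ht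
          exact hf.1 a
        · rw [Finset.card_image_of_injective _ hf.2, hT.2]; simp
      rw [← him, Finset.prod_image (fun a _ b _ h => hf.2 h)]
      simp
  · intro f hf
    simp only [Finset.mem_filter, Fintype.mem_piFinset] at hf
    rw [Finset.mem_powersetCard]
    refine ⟨?_, by rw [Finset.card_image_of_injective _ hf.2]; simp⟩
    intro t ht
    obtain ⟨a, _, rfl⟩ := Finset.mem_image.1 ht
    exact hf.1 a

theorem gram_mulVec {N : ℕ} {ι : Type*} (E : Finset ι) (w : ι → ℝ)
    (U V : ι → Fin N → ℝ) (φ : Fin N → ℝ) :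
    gram E w U V *ᵥ φ = ∑ t ∈ E, (w t * (V t ⬝ᵥ φ)) • U t := by
  ext a
  simp only [Matrix.mulVec, dotProduct, gram_apply, Finset.sum_apply, Pi.smul_apply, smul_eq_mul,
    Finset.sum_mul, Finset.mul_sum]
  rw [Finset.sum_comm]
  refine Finset.sum_congr rfl fun t _ => Finset.sum_congr rfl fun b _ => by ring

theorem det_gram_zero {N : ℕ} {ι : Type*} (E : Finset ι) (w : ι → ℝ)
    (U V : ι → Fin N → ℝ) (φ : Fin N → ℝ) (hφ : φ ≠ 0) (h : ∀ t ∈ E, V t ⬝ᵥ φ = 0) :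
    (gram E w U V).det = 0 := by
  rw [← Matrix.exists_mulVec_eq_zero_iff]
  refine ⟨φ, hφ, ?_⟩
  rw [gram_mulVec]
  exact Finset.sum_eq_zero fun t ht => by rw [h t ht]; simp

/-- Replacing one right-hand vector multiplies the determinant by a functional value. -/
theorem det_gram_swap {N : ℕ} {ι : Type*} [DecidableEq ι] (E : Finset ι) (ρ : ι) (hρ : ρ ∉ E)
    (U V : ι → Fin N → ℝ) (hUV : ∀ t ∈ E, V t = U t) (φ : Fin N → ℝ)
    (h : ∀ t ∈ E, U t ⬝ᵥ φ = 0) (h1 : U ρ ⬝ᵥ φ = 1) :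
    (gram (insert ρ E) (fun _ => 1) U V).det =
      (V ρ ⬝ᵥ φ) * (gram (insert ρ E) (fun _ => 1) U U).det := by
  set G := gram (insert ρ E) (fun _ => 1) U U with hG
  have hφ : G *ᵥ φ = U ρ := by
    rw [hG, gram_mulVec, Finset.sum_insert hρ, h1, Finset.sum_eq_zero]
    · simp
    · intro t ht; rw [h t ht]; simp
  have h2 : gram (insert ρ E) (fun _ => 1) U V =
      G * (1 + Matrix.replicateCol Unit φ * Matrix.replicateRow Unit (V ρ - U ρ)) := by
    rw [Matrix.mul_add, Matrix.mul_one, ← Matrix.vecMulVec_eq, Matrix.mul_vecMulVec, hφ, hG,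
      gram_insert _ _ _ _ _ hρ, gram_insert _ _ _ _ _ hρ,
      gram_congr E (fun _ => 1) (fun _ => 1) U V U U (fun _ _ => rfl) (fun _ _ => rfl) hUV]
    ext a b
    simp [Matrix.vecMulVec_apply]
    ring
  rw [h2, Matrix.det_mul, Matrix.det_one_add_replicateCol_mul_replicateRow, sub_dotProduct, h1]
  ring

theorem det_two_update_of_ne {N : ℕ} (A : Matrix (Fin N) (Fin N) ℝ) (hA : A.det ≠ 0)
    (e f g h : Fin N → ℝ) :
    A.det * (A + Matrix.vecMulVec e g + Matrix.vecMulVec f h).det =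
      (A + Matrix.vecMulVec e g).det * (A + Matrix.vecMulVec f h).det -
      ((A + Matrix.vecMulVec e h).det - A.det) * ((A + Matrix.vecMulVec f g).det - A.det) := by
  have hu : IsUnit A.det := isUnit_iff_ne_zero.2 hA
  have one : ∀ a b : Fin N → ℝ, (A + Matrix.vecMulVec a b).det =
      A.det * (1 + b ⬝ᵥ (A⁻¹ *ᵥ a)) := by
    intro a b
    rw [Matrix.vecMulVec_eq Unit, Matrix.det_add_mul _ _ hu, Matrix.det_unique (n := Unit)]
    simp [Matrix.mul_apply, dotProduct, Matrix.mulVec, Finset.mul_sum, Finset.sum_mul]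
    left
    rw [Finset.sum_comm]
    refine Finset.sum_congr rfl fun t _ => Finset.sum_congr rfl fun b _ => by ring
  have two : (A + Matrix.vecMulVec e g + Matrix.vecMulVec f h).det =
      A.det * ((1 + g ⬝ᵥ (A⁻¹ *ᵥ e)) * (1 + h ⬝ᵥ (A⁻¹ *ᵥ f)) -
        (g ⬝ᵥ (A⁻¹ *ᵥ f)) * (h ⬝ᵥ (A⁻¹ *ᵥ e))) := by
    have : A + Matrix.vecMulVec e g + Matrix.vecMulVec f h =
      A + (Matrix.of ![e, f]).transpose * Matrix.of ![g, h] := by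
      ext a b
      simp [Matrix.mul_apply, Matrix.vecMulVec_apply, Fin.sum_univ_two, add_assoc]
    rw [this, Matrix.det_add_mul _ _ hu, Matrix.det_fin_two]
    have hent : ∀ p q : Fin 2, (Matrix.of ![g, h] * A⁻¹ * (Matrix.of ![e, f]).transpose) p q =
        (![g, h] p) ⬝ᵥ (A⁻¹ *ᵥ (![e, f] q)) := by
      intro p q
      rw [Matrix.mul_assoc, Matrix.mul_apply]
      simp [dotProduct, Matrix.mulVec, Matrix.mul_apply]
    simp only [Matrix.add_apply, hent]
    simp
  rw [two, one, one, one, one]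
  ring

theorem det_two_update {N : ℕ} (A : Matrix (Fin N) (Fin N) ℝ)
    (e f g h : Fin N → ℝ) :
    A.det * (A + Matrix.vecMulVec e g + Matrix.vecMulVec f h).det =
      (A + Matrix.vecMulVec e g).det * (A + Matrix.vecMulVec f h).det -
      ((A + Matrix.vecMulVec e h).det - A.det) * ((A + Matrix.vecMulVec f g).det - A.det) := by
  let B : ℝ → Matrix (Fin N) (Fin N) ℝ := fun t => A + t • 1
  have hBc : Continuous B := by fun_prop
  let L : ℝ → ℝ := fun t =>
    (B t).det * (B t + Matrix.vecMulVec e g + Matrix.vecMulVec f h).det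
  let R : ℝ → ℝ := fun t =>
      (B t + Matrix.vecMulVec e g).det * (B t + Matrix.vecMulVec f h).det -
      ((B t + Matrix.vecMulVec e h).det - (B t).det) *
        ((B t + Matrix.vecMulVec f g).det - (B t).det)
  have hL : Continuous L := by
    apply Continuous.mul <;> apply Continuous.matrix_det <;> fun_prop
  have hR : Continuous R := by
    have hd : ∀ M : Matrix (Fin N) (Fin N) ℝ, Continuous fun t => (B t + M).det := by
      intro M; apply Continuous.matrix_det; fun_prop
    have hd0 : Continuous fun t => (B t).det := hBc.matrix_det
    exact ((hd _).mul (hd _)).sub (((hd _).sub hd0).mul ((hd _).sub hd0))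
  have hfin : {t : ℝ | (B t).det = 0}.Finite := by
    have hp : (-A).charpoly ≠ 0 := (Matrix.charpoly_monic _).ne_zero
    refine ((-A).charpoly.roots.toFinset.finite_toSet).subset ?_
    intro t ht
    simp only [Finset.mem_coe, Multiset.mem_toFinset, Polynomial.mem_roots hp,
      Polynomial.IsRoot.def]
    rw [Matrix.eval_charpoly]
    simp only [Set.mem_ofPred_eq] at ht
    rw [← ht]
    congr 1
    simp only [B, sub_neg_eq_add]
    rw [add_comm, Matrix.smul_one_eq_diagonal]
    rfl
  have hdense : Dense {t : ℝ | (B t).det = 0}ᶜ := hfin.countable.dense_compl ℝ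
  have hLR : L = R := by
    refine Continuous.ext_on hdense hL hR fun t ht => ?_
    exact det_two_update_of_ne (B t) ht e f g h
  have := congrFun hLR 0
  simpa [L, R, B] using this

/-- Integral incidence vectors; the diagonal pair `(r, r)` stands for a root. -/
def incZ {N : ℕ} (p : Fin N × Fin N) : Fin N → ℤ :=
  if p.1 = p.2 then Pi.single p.1 1 else Pi.single p.1 1 - Pi.single p.2 1

/-- Real incidence vectors. -/
def incR {N : ℕ} (p : Fin N × Fin N) : Fin N → ℝ := fun v => (incZ p v : ℝ)

theorem incR_root {N : ℕ} (r : Fin N) : incR (r, r) = Pi.single r 1 := by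
  ext v
  simp [incR, incZ, Pi.single_apply]

theorem incR_edge {N : ℕ} (p : Fin N × Fin N) (h : p.1 < p.2) :
    incR p = Pi.single p.1 1 - Pi.single p.2 1 := by
  ext v
  simp [incR, incZ, h.ne, Pi.single_apply]

theorem incR_edge_dot {N : ℕ} (p : Fin N × Fin N) (h : p.1 < p.2) (φ : Fin N → ℝ) :
    incR p ⬝ᵥ φ = φ p.1 - φ p.2 := by
  rw [incR_edge p h, sub_dotProduct]; simp

theorem edgeGraph_adj {N : ℕ} (T : Finset (Fin N × Fin N)) (a b : Fin N) :
    (edgeGraph T).Adj a b ↔ a ≠ b ∧ ((a, b) ∈ T ∨ (b, a) ∈ T) := by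
  simp [edgeGraph, SimpleGraph.fromRel_adj]

theorem edgeGraph_adj_of_mem {N : ℕ} (T : Finset (Fin N × Fin N)) (p : Fin N × Fin N)
    (hp : p ∈ T) (h : p.1 < p.2) : (edgeGraph T).Adj p.1 p.2 := by
  rw [edgeGraph_adj]; exact ⟨h.ne, Or.inl hp⟩

theorem card_edgeGraph {N : ℕ} (T : Finset (Fin N × Fin N)) (hT : ∀ p ∈ T, p.1 < p.2) :
    Nat.card (edgeGraph T).edgeSet = T.card := by
  have : (edgeGraph T).edgeSet = ((T.image fun p => s(p.1, p.2) : Finset _) : Set (Sym2 (Fin N))) := by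
    ext e
    induction e using Sym2.ind with
    | _ a b =>
      simp only [SimpleGraph.mem_edgeSet, edgeGraph_adj, Finset.coe_image, Set.mem_image,
        Finset.mem_coe, Sym2.eq_iff, Prod.exists]
      constructor
      · rintro ⟨_, h | h⟩
        · exact ⟨a, b, h, by simp⟩
        · exact ⟨b, a, h, by simp⟩
      · rintro ⟨c, d, h, ⟨rfl, rfl⟩ | ⟨rfl, rfl⟩⟩
        · exact ⟨(hT _ h).ne, Or.inl h⟩
        · exact ⟨(hT _ h).ne', Or.inr h⟩
  rw [this, Nat.card_coe_set_eq, Set.ncard_coe_finset, Finset.card_image_of_injOn]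
  rintro ⟨a, b⟩ hp ⟨c, d⟩ hq h
  have h1 := hT _ hp
  have h2 := hT _ hq
  simp only [Sym2.eq_iff] at h h1 h2
  rcases h with ⟨rfl, rfl⟩ | ⟨rfl, rfl⟩
  · rfl
  · exact absurd h1 h2.asymm

theorem isTree_iff_conn {N : ℕ} (T : Finset (Fin N × Fin N)) (hT : ∀ p ∈ T, p.1 < p.2)
    (hc : T.card + 1 = N) : (edgeGraph T).IsTree ↔ (edgeGraph T).Connected := by
  rw [SimpleGraph.isTree_iff_connected_and_card, card_edgeGraph T hT]
  simp [hc]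

theorem card_of_isTree {N : ℕ} (T : Finset (Fin N × Fin N)) (hT : ∀ p ∈ T, p.1 < p.2)
    (h : (edgeGraph T).IsTree) : T.card + 1 = N := by
  rw [SimpleGraph.isTree_iff_connected_and_card, card_edgeGraph T hT] at h
  simpa using h.2

theorem root_notMem {N : ℕ} (T : Finset (Fin N × Fin N)) (hT : ∀ p ∈ T, p.1 < p.2) (r : Fin N) :
    (r, r) ∉ T := fun h => lt_irrefl _ (hT _ h)

/-- A function constant on edges is constant on components. -/
theorem const_of_reachable {N : ℕ} {G : SimpleGraph (Fin N)} (P : Fin N → Prop)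
    (h : ∀ a b, G.Adj a b → P a → P b) {a b : Fin N} (hr : G.Reachable a b) (ha : P a) : P b := by
  obtain ⟨w⟩ := hr
  induction w with
  | nil => exact ha
  | cons hadj _ ih => exact ih (h _ _ hadj ha)

theorem det_conn {N : ℕ} (T : Finset (Fin N × Fin N)) (hT : ∀ p ∈ T, p.1 < p.2)
    (hc : T.card + 1 = N) (r : Fin N) (hconn : (edgeGraph T).Connected) :
    (gram (insert (r, r) T) (fun _ => 1) incR incR).det = 1 := by
  have hr := root_notMem T hT r
  have hcard : Fintype.card (Fin N) = Fintype.card (insert (r, r) T : Finset _) := by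
    rw [Fintype.card_coe, Finset.card_insert_of_notMem hr, hc]; simp
  let e := Fintype.equivOfCardEq hcard
  let M : Matrix (Fin N) (Fin N) ℤ := Matrix.of fun v x => incZ (e x).1 v
  have hspan : ∀ v, (Pi.single v 1 : Fin N → ℤ) ∈
      Submodule.span ℤ (Set.range fun x => incZ (e x).1) := by
    have hmem : ∀ p ∈ insert (r, r) T, incZ p ∈
        Submodule.span ℤ (Set.range fun x => incZ (e x).1) := by
      intro p hp
      apply Submodule.subset_span
      exact ⟨e.symm ⟨p, hp⟩, by simp⟩
    intro v
    refine const_of_reachable (fun v => (Pi.single v 1 : Fin N → ℤ) ∈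
      Submodule.span ℤ (Set.range fun x => incZ (e x).1)) ?_ (hconn.preconnected r v) ?_
    · intro a b hab ha
      rw [edgeGraph_adj] at hab
      rcases hab with ⟨hne, h | h⟩
      · have h1 := hmem _ (Finset.mem_insert_of_mem h)
        have hz : incZ (a, b) = Pi.single a 1 - Pi.single b 1 := by simp [incZ, hne]
        rw [hz] at h1
        have := Submodule.sub_mem _ ha h1
        simpa using this
      · have h1 := hmem _ (Finset.mem_insert_of_mem h)
        have hz : incZ (b, a) = Pi.single b 1 - Pi.single a 1 := by simp [incZ, hne.symm]
        rw [hz] at h1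
        have := Submodule.add_mem _ h1 ha
        simpa using this
    · have h1 := hmem _ (Finset.mem_insert_self _ _)
      simpa [incZ] using h1
  simp only [Submodule.mem_span_range_iff_exists_fun] at hspan
  choose c hcc using hspan
  let X : Matrix (Fin N) (Fin N) ℤ := Matrix.of fun x v => c v x
  have hMX : M * X = 1 := by
    ext a v
    have := congrFun (hcc v) a
    simp only [Finset.sum_apply, Pi.smul_apply, smul_eq_mul] at this
    rw [Matrix.mul_apply, Matrix.one_apply]
    simp only [M, X, Matrix.of_apply]
    rw [Pi.single_apply] at this
    rw [← this]
    exact Finset.sum_congr rfl fun x _ => mul_comm _ _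
  have hdet : M.det * X.det = 1 := by rw [← Matrix.det_mul, hMX, Matrix.det_one]
  have hsq : M.det * M.det = 1 := by
    rcases Int.isUnit_iff.1 (IsUnit.of_mul_eq_one _ hdet) with h | h <;> simp [h]
  have hG : gram (insert (r, r) T) (fun _ => 1) incR incR =
      (M * M.transpose).map (Int.castRingHom ℝ) := by
    ext a b
    rw [gram_apply, Matrix.map_apply, Matrix.mul_apply, ← Finset.sum_coe_sort, ← e.sum_comp]
    simp [M, incR]
  rw [hG]
  have := (Int.castRingHom ℝ).map_det (M * M.transpose)
  rw [RingHom.mapMatrix_apply] at this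
  rw [← this, Matrix.det_mul, Matrix.det_transpose, hsq]
  simp

theorem det_not_conn {N : ℕ} (T : Finset (Fin N × Fin N)) (hT : ∀ p ∈ T, p.1 < p.2)
    (r : Fin N) (hconn : ¬ (edgeGraph T).Connected) (U V : Fin N × Fin N → Fin N → ℝ)
    (hV : ∀ p ∈ insert (r, r) T, V p = incR p ∨ V p = -incR p) :
    (gram (insert (r, r) T) (fun _ => 1) U V).det = 0 := by
  obtain ⟨b, hb⟩ : ∃ b, ¬ (edgeGraph T).Reachable r b := by
    by_contra h
    push Not at h
    have : Nonempty (Fin N) := ⟨r⟩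
    exact hconn ⟨fun a b => (h a).symm.trans (h b)⟩
  refine det_gram_zero _ _ _ _ (fun v => if (edgeGraph T).Reachable r v then 0 else 1) ?_ ?_
  · intro h
    have := congrFun h b
    simp [hb] at this
  · intro p hp
    suffices hs : incR p ⬝ᵥ (fun v => if (edgeGraph T).Reachable r v then (0 : ℝ) else 1) = 0 by
      rcases hV p hp with h | h <;> simp [h, hs]
    rcases Finset.mem_insert.1 hp with rfl | hp
    · rw [incR_root]; simp
    · rw [incR_edge_dot p (hT p hp)]
      have hadj := edgeGraph_adj_of_mem T p hp (hT p hp)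
      have : (edgeGraph T).Reachable r p.1 ↔ (edgeGraph T).Reachable r p.2 :=
        ⟨fun h => h.trans hadj.reachable, fun h => h.trans hadj.reachable.symm⟩
      simp [this]

theorem det_tree {N : ℕ} (T : Finset (Fin N × Fin N)) (hT : ∀ p ∈ T, p.1 < p.2)
    (hc : T.card + 1 = N) (r : Fin N) :
    (gram (insert (r, r) T) (fun _ => 1) incR incR).det =
      if (edgeGraph T).IsTree then 1 else 0 := by
  rw [isTree_iff_conn T hT hc]
  split_ifs with h
  · exact det_conn T hT hc r h
  · exact det_not_conn T hT r h _ _ fun _ _ => Or.inl rfl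

/-- Cauchy–Binet with a root. -/
theorem root_cauchy_binet {N n : ℕ} (hN : n + 1 = N) (E : Finset (Fin N × Fin N))
    (hE : ∀ p ∈ E, p.1 < p.2) (r : Fin N) (w : Fin N × Fin N → ℝ) (hw : w (r, r) = 1)
    (U V : Fin N × Fin N → Fin N → ℝ) (hV : ∀ p ∈ E, V p ⬝ᵥ (fun _ => 1) = 0) :
    (gram (insert (r, r) E) w U V).det = ∑ T ∈ E.powersetCard n,
      (∏ t ∈ T, w t) * (gram (insert (r, r) T) (fun _ => 1) U V).det := by
  have hr := root_notMem E hE r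
  rw [cauchy_binet]
  have hp : Finset.powersetCard N (insert (r, r) E) =
      Finset.powersetCard N E ∪ (Finset.powersetCard n E).image (insert (r, r)) := by
    subst hN
    exact Finset.powersetCard_succ_insert hr n
  rw [hp, Finset.sum_union, Finset.sum_eq_zero, zero_add, Finset.sum_image]
  · refine Finset.sum_congr rfl fun T hT => ?_
    have : (r, r) ∉ T := fun h => hr ((Finset.mem_powersetCard.1 hT).1 h)
    rw [Finset.prod_insert this, hw, one_mul]
  · intro S hS T hT h
    have h1 : (r, r) ∉ S := fun h => hr ((Finset.mem_powersetCard.1 hS).1 h)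
    have h2 : (r, r) ∉ T := fun h => hr ((Finset.mem_powersetCard.1 hT).1 h)
    rw [← Finset.erase_insert h1, ← Finset.erase_insert h2, h]
  · intro T hT
    rw [det_gram_zero T _ U V (fun _ => 1), mul_zero]
    · intro h; simpa using congrFun h r
    · exact fun t ht => hV t ((Finset.mem_powersetCard.1 hT).1 ht)
  · rw [Finset.disjoint_left]
    intro T hT hT'
    obtain ⟨S, _, rfl⟩ := Finset.mem_image.1 hT'
    exact hr ((Finset.mem_powersetCard.1 hT).1 (Finset.mem_insert_self _ _))

/-- Matrix-tree theorem. -/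
theorem matrix_tree {N : ℕ} (E : Finset (Fin N × Fin N))
    (hE : ∀ p ∈ E, p.1 < p.2) (r : Fin N) (w : Fin N × Fin N → ℝ) (hw : w (r, r) = 1) :
    (gram (insert (r, r) E) w incR incR).det =
      ∑ T ∈ E.powerset.filter (fun T => (edgeGraph T).IsTree), ∏ t ∈ T, w t := by
  obtain ⟨n, hN⟩ : ∃ n, n + 1 = N := ⟨N - 1, by have := r.2; omega⟩
  rw [root_cauchy_binet hN E hE r w hw]
  · rw [Finset.powersetCard_eq_filter, Finset.sum_filter, Finset.sum_filter]
    refine Finset.sum_congr rfl fun T hT => ?_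
    have hT' : ∀ p ∈ T, p.1 < p.2 := fun p hp => hE p (Finset.mem_powerset.1 hT hp)
    split_ifs with h1 h2 h2
    · rw [det_tree T hT' (by omega), if_pos h2, mul_one]
    · rw [det_tree T hT' (by omega), if_neg h2, mul_zero]
    · exact absurd (card_of_isTree T hT' h2) (by omega)
    · rfl
  · intro p hp
    rw [incR_edge_dot p (hE p hp)]; simp

theorem gram_transpose {N : ℕ} {ι : Type*} (E : Finset ι) (w : ι → ℝ)
    (U V : ι → Fin N → ℝ) : (gram E w U V).transpose = gram E w V U := by
  ext a b
  rw [Matrix.transpose_apply, gram_apply, gram_apply]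
  exact Finset.sum_congr rfl fun t _ => by ring

theorem redPair_lt {N : ℕ} {i j : Fin N} (h : i ≠ j) : (redPair i j).1 < (redPair i j).2 := by
  simp [redPair, h.symm]

theorem redPair_cases {N : ℕ} (i j : Fin N) : redPair i j = (i, j) ∨ redPair i j = (j, i) := by
  rcases le_total i j with h | h
  · left; simp [redPair, h]
  · right; simp [redPair, h]

/-- Signed vector of an (oriented) red edge. -/
def vec {N : ℕ} (i j : Fin N) : Fin N → ℝ := Pi.single i 1 - Pi.single j 1

theorem vec_dot {N : ℕ} (i j : Fin N) (φ : Fin N → ℝ) : vec i j ⬝ᵥ φ = φ i - φ j := by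
  rw [vec, sub_dotProduct]; simp

theorem vec_redPair {N : ℕ} {i j : Fin N} (h : i ≠ j) :
    vec i j = incR (redPair i j) ∨ vec i j = -incR (redPair i j) := by
  rw [incR_edge _ (redPair_lt h)]
  rcases redPair_cases i j with h | h <;> rw [h] <;> simp [vec]

theorem vecMulVec_redPair {N : ℕ} {i j : Fin N} (h : i ≠ j) :
    Matrix.vecMulVec (vec i j) (vec i j) =
      Matrix.vecMulVec (incR (redPair i j)) (incR (redPair i j)) := by
  rcases vec_redPair h with h | h <;> rw [h]
  simp [Matrix.vecMulVec_neg, Matrix.neg_vecMulVec]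

theorem edgeGraph_insert {N : ℕ} (F : Finset (Fin N × Fin N)) {i j : Fin N} :
    edgeGraph (insert (redPair i j) F) = edgeGraph F ⊔ SimpleGraph.edge i j := by
  ext a b
  rw [SimpleGraph.sup_adj, edgeGraph_adj, edgeGraph_adj, SimpleGraph.edge_adj]
  simp only [Finset.mem_insert]
  rcases redPair_cases i j with h | h <;> rw [h] <;> simp only [Prod.mk.injEq] <;> tauto

theorem cover_iff {N : ℕ} (F : Finset (Fin N × Fin N)) {i j : Fin N} (hij : i ≠ j) :
    (edgeGraph (insert (redPair i j) F)).Connected ↔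
      ∀ v, (edgeGraph F).Reachable i v ∨ (edgeGraph F).Reachable j v := by
  rw [edgeGraph_insert]
  constructor
  · intro h v
    refine const_of_reachable
      (fun v => (edgeGraph F).Reachable i v ∨ (edgeGraph F).Reachable j v) ?_
      (h.preconnected i v) (Or.inl (SimpleGraph.Reachable.refl _))
    intro a b hab ha
    rw [SimpleGraph.sup_adj, SimpleGraph.edge_adj] at hab
    rcases hab with hab | ⟨⟨rfl, rfl⟩ | ⟨rfl, rfl⟩, _⟩
    · exact ha.imp (fun h => h.trans hab.reachable) (fun h => h.trans hab.reachable)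
    · exact Or.inr (SimpleGraph.Reachable.refl _)
    · exact Or.inl (SimpleGraph.Reachable.refl _)
  · intro h
    have hadj : (edgeGraph F ⊔ SimpleGraph.edge i j).Adj i j := by
      rw [SimpleGraph.sup_adj, SimpleGraph.edge_adj]; simp [hij]
    have hi : ∀ v, (edgeGraph F ⊔ SimpleGraph.edge i j).Reachable i v := by
      intro v
      rcases h v with h | h
      · exact h.mono le_sup_left
      · exact hadj.reachable.trans (h.mono le_sup_left)
    have : Nonempty (Fin N) := ⟨i⟩
    exact ⟨fun a b => (hi a).symm.trans (hi b)⟩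

theorem card_two_iff {N : ℕ} (G : SimpleGraph (Fin N)) {i j : Fin N}
    (hij : ¬ G.Reachable i j) :
    Nat.card G.ConnectedComponent = 2 ↔ ∀ v, G.Reachable i v ∨ G.Reachable j v := by
  rw [Nat.card_eq_two_iff' (G.connectedComponentMk i)]
  constructor
  · rintro ⟨c, _, hc⟩ v
    have h1 := hc (G.connectedComponentMk j)
      (fun h => hij (SimpleGraph.ConnectedComponent.exact h).symm)
    by_cases h : G.Reachable i v
    · exact Or.inl h
    · have h2 := hc (G.connectedComponentMk v)
        (fun h' => h (SimpleGraph.ConnectedComponent.exact h').symm)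
      exact Or.inr (SimpleGraph.ConnectedComponent.exact (h1.trans h2.symm))
  · intro h
    refine ⟨G.connectedComponentMk j,
      fun h => hij (SimpleGraph.ConnectedComponent.exact h).symm, ?_⟩
    intro c
    induction c using SimpleGraph.ConnectedComponent.ind with
    | _ v =>
      intro hv
      rcases h v with h | h
      · exact absurd (SimpleGraph.ConnectedComponent.sound h.symm) hv
      · exact SimpleGraph.ConnectedComponent.sound h.symm

/-- The forest condition of `twoForests`, without the containment in the black edges. -/
def ForestCond {N : ℕ} (F : Finset (Fin N × Fin N)) (i j k l : Fin N) : Prop :=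
  (edgeGraph F).IsAcyclic ∧ Nat.card (edgeGraph F).ConnectedComponent = 2 ∧
    ¬ (edgeGraph F).Reachable i j ∧ ¬ (edgeGraph F).Reachable k l

theorem ForestCond.isTree {N : ℕ} {F : Finset (Fin N × Fin N)} {i j k l : Fin N} (hij : i ≠ j)
    (h : ForestCond F i j k l) : (edgeGraph (insert (redPair i j) F)).IsTree := by
  obtain ⟨h1, h2, h3, _⟩ := h
  refine ⟨(cover_iff F hij).2 ((card_two_iff _ h3).1 h2), ?_⟩
  rw [edgeGraph_insert]
  exact h1.sup_edge_of_not_reachable h3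

theorem det_forest {N : ℕ} (F : Finset (Fin N × Fin N)) (hF : ∀ p ∈ F, p.1 < p.2)
    (hc : F.card + 2 = N) (i j k l r : Fin N) (hij : i ≠ j) (hρ : redPair i j ∉ F) :
    (gram (insert (r, r) (insert (redPair i j) F)) (fun _ => 1)
      (Function.update incR (redPair i j) (vec i j))
      (Function.update incR (redPair i j) (vec k l))).det =
      if ForestCond F i j k l then (if (edgeGraph F).Reachable i k then 1 else -1) else 0 := by
  set ρ := redPair i j with hρdef
  have hT : ∀ p ∈ insert ρ F, p.1 < p.2 := by
    intro p hp
    rcases Finset.mem_insert.1 hp with rfl | hp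
    · exact redPair_lt hij
    · exact hF p hp
  have hrρ : (r, r) ≠ ρ := fun h => root_notMem _ hT r (h ▸ Finset.mem_insert_self _ _)
  by_cases hconn : (edgeGraph (insert ρ F)).Connected
  · have hcard : (insert ρ F).card + 1 = N := by
      rw [Finset.card_insert_of_notMem hρ]; omega
    have htree := (isTree_iff_conn _ hT hcard).2 hconn
    have hcov := (cover_iff F hij).1 hconn
    have hnij : ¬ (edgeGraph F).Reachable i j := by
      intro h
      have hi : ∀ v, (edgeGraph F).Reachable i v := fun v =>
        (hcov v).elim id fun h' => h.trans h'
      have : Nonempty (Fin N) := ⟨i⟩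
      have hFc : (edgeGraph F).Connected := ⟨fun a b => (hi a).symm.trans (hi b)⟩
      have := hFc.card_vert_le_card_edgeSet_add_one
      rw [card_edgeGraph F hF] at this
      simp at this
      omega
    have hac : (edgeGraph F).IsAcyclic := by
      refine SimpleGraph.IsAcyclic.anti ?_ htree.isAcyclic
      rw [hρdef, edgeGraph_insert]; exact le_sup_left
    have htwo := (card_two_iff _ hnij).2 hcov
    let ψ : Fin N → ℝ := fun v => if (edgeGraph F).Reachable i v then 1 else 0
    rw [Finset.insert_comm]
    rw [det_gram_swap (insert (r, r) F) ρ (by simp [hρ, hrρ.symm]) _ _ ?_ (fun v => ψ v - ψ r)]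
    · have hUU : gram (insert ρ (insert (r, r) F)) (fun _ => 1)
          (Function.update incR ρ (vec i j)) (Function.update incR ρ (vec i j)) =
          gram (insert (r, r) (insert ρ F)) (fun _ => 1) incR incR := by
        rw [Finset.insert_comm]
        refine Finset.sum_congr rfl fun t _ => ?_
        by_cases h : t = ρ
        · subst h; rw [Function.update_self, vecMulVec_redPair hij]
        · rw [Function.update_of_ne h]
      rw [hUU, det_conn _ hT hcard r hconn, Function.update_self, vec_dot, mul_one]
      by_cases hkl : (edgeGraph F).Reachable k l
      · have : ¬ ForestCond F i j k l := fun h => h.2.2.2 hkl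
        rw [if_neg this]
        have : (edgeGraph F).Reachable i k ↔ (edgeGraph F).Reachable i l :=
          ⟨fun h => h.trans hkl, fun h => h.trans hkl.symm⟩
        simp [ψ, this]
      · have : ForestCond F i j k l := ⟨hac, htwo, hnij, hkl⟩
        rw [if_pos this]
        by_cases hik : (edgeGraph F).Reachable i k
        · have hil : ¬ (edgeGraph F).Reachable i l := fun h => hkl (hik.symm.trans h)
          simp [ψ, hik, hil]
        · have hil : (edgeGraph F).Reachable i l := by
            by_contra hil
            exact hkl (((hcov k).resolve_left hik).symm.trans ((hcov l).resolve_left hil))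
          simp [ψ, hik, hil]
          ring
    · intro t ht
      have htρ : t ≠ ρ := by rintro rfl; simp [hρ, hrρ.symm] at ht
      rw [Function.update_of_ne htρ]
      rcases Finset.mem_insert.1 ht with rfl | ht
      · rw [incR_root]; simp
      · rw [incR_edge_dot t (hF t ht)]
        have hadj := edgeGraph_adj_of_mem F t ht (hF t ht)
        have : (edgeGraph F).Reachable i t.1 ↔ (edgeGraph F).Reachable i t.2 :=
          ⟨fun h => h.trans hadj.reachable, fun h => h.trans hadj.reachable.symm⟩
        simp [ψ, this]
    · rw [Function.update_self, vec_dot]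
      simp [ψ, hnij]
    · intro t ht
      have htρ : t ≠ ρ := by rintro rfl; simp [hρ, hrρ.symm] at ht
      rw [Function.update_of_ne htρ, Function.update_of_ne htρ]
  · have : ¬ ForestCond F i j k l := fun h => hconn (h.isTree hij).connected
    rw [if_neg this, ← Matrix.det_transpose, gram_transpose]
    refine det_not_conn _ hT r hconn _ _ ?_
    intro p hp
    by_cases h : p = ρ
    · subst h; rw [Function.update_self]; exact vec_redPair hij
    · rw [Function.update_of_ne h]; exact Or.inl rfl

/-- The mixed determinant is the signed forest sum. -/
theorem mixed_det {N : ℕ} (E : Finset (Fin N × Fin N)) (hE : ∀ p ∈ E, p.1 < p.2)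
    (i j k l r : Fin N) (hij : i ≠ j) (hρ : redPair i j ∉ E) (w : Fin N × Fin N → ℝ)
    (hw : w (r, r) = 1) (hw1 : w (redPair i j) = 1) :
    (gram (insert (r, r) E) w incR incR + Matrix.vecMulVec (vec i j) (vec k l)).det -
      (gram (insert (r, r) E) w incR incR).det =
      ∑ F ∈ E.powerset.filter (fun F => ForestCond F i j k l),
        (if (edgeGraph F).Reachable i k then (1 : ℝ) else -1) * ∏ t ∈ F, w t := by
  set ρ := redPair i j with hρdef
  obtain ⟨m, hN⟩ : ∃ m, m + 1 + 1 = N := by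
    refine ⟨N - 2, ?_⟩
    have h1 := i.2
    have h2 := j.2
    have h3 : i.1 ≠ j.1 := fun h => hij (Fin.ext h)
    omega
  have hT : ∀ p ∈ insert ρ E, p.1 < p.2 := by
    intro p hp
    rcases Finset.mem_insert.1 hp with rfl | hp
    · exact redPair_lt hij
    · exact hE p hp
  have hrρ : (r, r) ≠ ρ := fun h => root_notMem _ hT r (h ▸ Finset.mem_insert_self _ _)
  have hrE := root_notMem E hE r
  have hU : ∀ (f : Fin N → ℝ) (t), t ∈ insert (r, r) E → incR t = Function.update incR ρ f t := by
    intro f t ht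
    have htρ : t ≠ ρ := by rintro rfl; simp [hρ, hrρ.symm] at ht
    rw [Function.update_of_ne htρ]
  have hbig : gram (insert (r, r) E) w incR incR + Matrix.vecMulVec (vec i j) (vec k l) =
      gram (insert (r, r) (insert ρ E)) w (Function.update incR ρ (vec i j))
        (Function.update incR ρ (vec k l)) := by
    rw [Finset.insert_comm, gram_insert _ _ _ _ ρ (by simp [hρ, hrρ.symm]), hw1, one_smul,
      Function.update_self, Function.update_self]
    congr 1
    exact gram_congr _ _ _ _ _ _ _ (fun _ _ => rfl) (hU _) (hU _)
  rw [hbig, root_cauchy_binet hN (insert ρ E) hT r w hw, root_cauchy_binet hN E hE r w hw,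
    Finset.powersetCard_succ_insert hρ, Finset.sum_union, Finset.sum_image]
  · rw [add_sub_assoc, add_comm, sub_add]
    have h0 : ∑ T ∈ Finset.powersetCard (m + 1) E, (∏ t ∈ T, w t) *
          (gram (insert (r, r) T) (fun _ => 1) incR incR).det =
        ∑ T ∈ Finset.powersetCard m.succ E, (∏ t ∈ T, w t) *
          (gram (insert (r, r) T) (fun _ => 1) (Function.update incR ρ (vec i j))
            (Function.update incR ρ (vec k l))).det := by
      refine Finset.sum_congr rfl fun T hT => ?_
      have hsub : ∀ t ∈ insert (r, r) T, t ∈ insert (r, r) E :=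
        Finset.insert_subset_insert _ (Finset.mem_powersetCard.1 hT).1
      rw [gram_congr (insert (r, r) T) (fun _ => 1) (fun _ => 1) incR incR _ _ (fun _ _ => rfl)
        (fun t ht => hU (vec i j) t (hsub t ht)) (fun t ht => hU (vec k l) t (hsub t ht))]
    rw [h0, sub_self, sub_zero]
    rw [Finset.powersetCard_eq_filter, Finset.sum_filter, Finset.sum_filter]
    refine Finset.sum_congr rfl fun F hF => ?_
    have hFE := Finset.mem_powerset.1 hF
    have hF' : ∀ p ∈ F, p.1 < p.2 := fun p hp => hE p (hFE hp)
    have hρF : ρ ∉ F := fun h => hρ (hFE h)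
    by_cases hcard : F.card = m
    · rw [if_pos hcard, det_forest F hF' (by omega) i j k l r hij hρF,
        Finset.prod_insert hρF, hw1]
      split_ifs <;> ring
    · rw [if_neg hcard, if_neg]
      intro hcond
      have := card_of_isTree _ (fun p hp => hT p (Finset.insert_subset_insert _ hFE hp))
        (hcond.isTree hij)
      rw [Finset.card_insert_of_notMem hρF] at this
      omega
  · intro S hS T hT h
    have h1 : ρ ∉ S := fun h => hρ ((Finset.mem_powersetCard.1 hS).1 h)
    have h2 : ρ ∉ T := fun h => hρ ((Finset.mem_powersetCard.1 hT).1 h)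
    rw [← Finset.erase_insert h1, ← Finset.erase_insert h2, h]
  · rw [Finset.disjoint_left]
    intro T hT hT'
    obtain ⟨S, _, rfl⟩ := Finset.mem_image.1 hT'
    exact hρ ((Finset.mem_powersetCard.1 hT).1 (Finset.mem_insert_self _ _))
  · intro p hp
    rw [incR_edge_dot p (hE p hp)]; simp
  · intro p hp
    by_cases h : p = ρ
    · subst h; rw [Function.update_self, vec_dot]; simp
    · rw [Function.update_of_ne h, incR_edge_dot p (hT p hp)]; simp

theorem gram_insert_red {N : ℕ} (E : Finset (Fin N × Fin N)) (i j r : Fin N) (hij : i ≠ j)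
    (hρ : redPair i j ∉ E) (w : Fin N × Fin N → ℝ) (hw1 : w (redPair i j) = 1) :
    gram (insert (r, r) E) w incR incR + Matrix.vecMulVec (vec i j) (vec i j) =
      gram (insert (r, r) (insert (redPair i j) E)) w incR incR := by
  have hrρ : redPair i j ≠ (r, r) := by
    intro h
    have := redPair_lt hij
    rw [h] at this
    exact lt_irrefl _ this
  rw [Finset.insert_comm, gram_insert _ _ _ _ (redPair i j) (by simp [hρ, hrρ]), hw1, one_smul,
    vecMulVec_redPair hij]

end Helpers

/-- **Discriminant as a signed count of spanning 2-forests.**  For a connected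
weighted graph with two red edges `{i,j}` and `{k,l}` (all black weights
positive), `Δ = −( Σ_{F ∈ F²_{U,W}} ε(F) π(F) )²`, where `ε(F) = +1` iff `i`
and `k` lie in the same component of `F`. -/
theorem discriminant_eq_neg_square_forest_sum
    {N : ℕ} (γ : Fin N → Fin N → ℝ)
    (hsym : ∀ a b, γ a b = γ b a) (hdiag : ∀ a, γ a a = 0)
    (hpos : ∀ a b, 0 ≤ γ a b)
    (i j k l : Fin N) (hij : i ≠ j) (hkl : k ≠ l)
    (hne : ({i, j} : Finset (Fin N)) ≠ {k, l})
    (hred1 : γ i j = 0) (hred2 : γ k l = 0)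
    (hconn : (edgeGraph (blackE γ ∪ {redPair i j, redPair k l})).Connected) :
    crossDisc γ i j k l =
      -(∑ F ∈ twoForests γ i j k l,
          (if (edgeGraph F).Reachable i k then (1 : ℝ) else -1) * prodWeight γ F) ^ 2 := by
  set ρ₁ := redPair i j with hρ₁
  set ρ₂ := redPair k l with hρ₂
  set E := blackE γ with hEdef
  have hlt1 : ρ₁.1 < ρ₁.2 := redPair_lt hij
  have hlt2 : ρ₂.1 < ρ₂.2 := redPair_lt hkl
  have hE : ∀ p ∈ E, p.1 < p.2 := by
    intro p hp
    simp only [hEdef, blackE, Finset.mem_filter] at hp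
    exact hp.2.1
  have h1E : ρ₁ ∉ E := by
    intro h
    simp only [hEdef, blackE, Finset.mem_filter] at h
    apply h.2.2
    rcases redPair_cases i j with h | h <;> rw [hρ₁, h]
    · exact hred1
    · rw [hsym]; exact hred1
  have h2E : ρ₂ ∉ E := by
    intro h
    simp only [hEdef, blackE, Finset.mem_filter] at h
    apply h.2.2
    rcases redPair_cases k l with h | h <;> rw [hρ₂, h]
    · exact hred2
    · rw [hsym]; exact hred2
  have h12 : ρ₁ ≠ ρ₂ := by
    intro h
    apply hne
    rcases redPair_cases i j with h1 | h1 <;> rcases redPair_cases k l with h2 | h2 <;>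
      rw [hρ₁, hρ₂, h1, h2, Prod.mk.injEq] at h <;> obtain ⟨rfl, rfl⟩ := h
    · rfl
    · exact Finset.pair_comm _ _
    · exact Finset.pair_comm _ _
    · rfl
  let w : Fin N × Fin N → ℝ := fun p =>
    if p = ρ₁ ∨ p = ρ₂ ∨ p.1 = p.2 then 1 else γ p.1 p.2
  have hwr : w (i, i) = 1 := by simp [w]
  have hw1 : w ρ₁ = 1 := by simp [w]
  have hw2 : w ρ₂ = 1 := by simp [w]
  have hwE : ∀ p ∈ E, w p = γ p.1 p.2 := by
    intro p hp
    have a1 : p ≠ ρ₁ := fun h => h1E (h ▸ hp)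
    have a2 : p ≠ ρ₂ := fun h => h2E (h ▸ hp)
    simp [w, a1, a2, (hE p hp).ne]
  have hprod : ∀ T ⊆ E ∪ {ρ₁, ρ₂}, ∏ t ∈ T, w t = prodWeight γ (T \ {ρ₁, ρ₂}) := by
    intro T hT
    rw [← Finset.prod_inter_mul_prod_sdiff T {ρ₁, ρ₂}]
    have : ∏ x ∈ T ∩ {ρ₁, ρ₂}, w x = 1 := by
      refine Finset.prod_eq_one fun t ht => ?_
      have := (Finset.mem_inter.1 ht).2
      simp only [Finset.mem_insert, Finset.mem_singleton] at this
      rcases this with rfl | rfl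
      · exact hw1
      · exact hw2
    rw [this, one_mul, prodWeight]
    refine Finset.prod_congr rfl fun t ht => hwE t ?_
    rw [Finset.mem_sdiff] at ht
    exact (Finset.mem_union.1 (hT ht.1)).resolve_right ht.2
  -- tree sums
  have htr : ∀ E' ⊆ E ∪ {ρ₁, ρ₂},
      ∑ T ∈ E'.powerset.filter (fun T => (edgeGraph T).IsTree), ∏ t ∈ T, w t =
      ∑ T ∈ spTrees γ i j k l, if T ⊆ E' then prodWeight γ (T \ {ρ₁, ρ₂}) else 0 := by
    intro E' hE'
    rw [← Finset.sum_filter]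
    refine Finset.sum_congr ?_ ?_
    · ext T
      simp only [Finset.mem_filter, Finset.mem_powerset, spTrees, Finset.mem_univ, true_and]
      constructor
      · rintro ⟨h1, h2⟩; exact ⟨⟨h1.trans hE', h2⟩, h1⟩
      · rintro ⟨⟨_, h2⟩, h1⟩; exact ⟨h1, h2⟩
    · intro T hT
      rw [Finset.mem_filter] at hT
      exact hprod T (hT.2.trans hE')
  have hco : ∀ b1 b2, coeffA γ i j k l b1 b2 = ∑ T ∈ spTrees γ i j k l,
      if (ρ₁ ∈ T ↔ b1 = true) ∧ (ρ₂ ∈ T ↔ b2 = true) then prodWeight γ (T \ {ρ₁, ρ₂}) else 0 := by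
    intro b1 b2
    rw [coeffA, Finset.sum_filter]
  have hsp : ∀ T ∈ spTrees γ i j k l, ∀ p ∈ T, p ∈ E ∨ p = ρ₁ ∨ p = ρ₂ := by
    intro T hT p hp
    simp only [spTrees, Finset.mem_filter] at hT
    have h := hT.2.1 hp
    simp only [Finset.mem_union, Finset.mem_insert, Finset.mem_singleton] at h
    exact h
  have sub0 : ∀ T ∈ spTrees γ i j k l, (T ⊆ E ↔ ρ₁ ∉ T ∧ ρ₂ ∉ T) := by
    intro T hT
    refine ⟨fun h => ⟨fun h' => h1E (h h'), fun h' => h2E (h h')⟩, fun h p hp => ?_⟩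
    rcases hsp T hT p hp with h' | rfl | rfl
    · exact h'
    · exact absurd hp h.1
    · exact absurd hp h.2
  have sub1 : ∀ T ∈ spTrees γ i j k l, (T ⊆ insert ρ₁ E ↔ ρ₂ ∉ T) := by
    intro T hT
    refine ⟨fun h h' => ?_, fun h p hp => ?_⟩
    · rcases Finset.mem_insert.1 (h h') with h | h
      · exact h12 h.symm
      · exact h2E h
    · rcases hsp T hT p hp with h' | rfl | rfl
      · exact Finset.mem_insert_of_mem h'
      · exact Finset.mem_insert_self _ _
      · exact absurd hp h
  have sub2 : ∀ T ∈ spTrees γ i j k l, (T ⊆ insert ρ₂ E ↔ ρ₁ ∉ T) := by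
    intro T hT
    refine ⟨fun h h' => ?_, fun h p hp => ?_⟩
    · rcases Finset.mem_insert.1 (h h') with h | h
      · exact h12 h
      · exact h1E h
    · rcases hsp T hT p hp with h' | rfl | rfl
      · exact Finset.mem_insert_of_mem h'
      · exact absurd hp h
      · exact Finset.mem_insert_self _ _
  have sub12 : ∀ T ∈ spTrees γ i j k l, T ⊆ insert ρ₂ (insert ρ₁ E) := by
    intro T hT p hp
    rcases hsp T hT p hp with h' | rfl | rfl <;> simp_all
  have hE1 : ∀ p ∈ insert ρ₁ E, p.1 < p.2 := by
    intro p hp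
    rcases Finset.mem_insert.1 hp with rfl | hp
    · exact hlt1
    · exact hE p hp
  have hE2 : ∀ p ∈ insert ρ₂ E, p.1 < p.2 := by
    intro p hp
    rcases Finset.mem_insert.1 hp with rfl | hp
    · exact hlt2
    · exact hE p hp
  have hE12 : ∀ p ∈ insert ρ₂ (insert ρ₁ E), p.1 < p.2 := by
    intro p hp
    rcases Finset.mem_insert.1 hp with rfl | hp
    · exact hlt2
    · exact hE1 p hp
  set A := gram (insert (i, i) E) w incR incR with hA
  have d0 : A.det = coeffA γ i j k l false false := by
    rw [hA, matrix_tree E hE i w hwr, htr E Finset.subset_union_left, hco]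
    refine Finset.sum_congr rfl fun T hT => ?_
    simp only [sub0 T hT]
    by_cases a1 : ρ₁ ∈ T <;> by_cases a2 : ρ₂ ∈ T <;> simp [a1, a2]
  have d1 : (A + Matrix.vecMulVec (vec i j) (vec i j)).det =
      coeffA γ i j k l true false + coeffA γ i j k l false false := by
    rw [hA, gram_insert_red E i j i hij h1E w hw1, matrix_tree _ hE1 i w hwr, htr, hco, hco,
      ← Finset.sum_add_distrib]
    · refine Finset.sum_congr rfl fun T hT => ?_
      simp only [sub1 T hT]
      by_cases a1 : ρ₁ ∈ T <;> by_cases a2 : ρ₂ ∈ T <;> simp [a1, a2]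
    · intro p; simp; tauto
  have d2 : (A + Matrix.vecMulVec (vec k l) (vec k l)).det =
      coeffA γ i j k l false true + coeffA γ i j k l false false := by
    rw [hA, gram_insert_red E k l i hkl h2E w hw2, matrix_tree _ hE2 i w hwr, htr, hco, hco,
      ← Finset.sum_add_distrib]
    · refine Finset.sum_congr rfl fun T hT => ?_
      simp only [sub2 T hT]
      by_cases a1 : ρ₁ ∈ T <;> by_cases a2 : ρ₂ ∈ T <;> simp [a1, a2]
    · intro p; simp; tauto
  have d12 : (A + Matrix.vecMulVec (vec i j) (vec i j) + Matrix.vecMulVec (vec k l) (vec k l)).det =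
      coeffA γ i j k l true true + coeffA γ i j k l true false +
        coeffA γ i j k l false true + coeffA γ i j k l false false := by
    rw [hA, gram_insert_red E i j i hij h1E w hw1,
      gram_insert_red _ k l i hkl (by simp [← hρ₁, ← hρ₂, h12.symm, h2E]) w hw2,
      matrix_tree _ hE12 i w hwr, htr, hco, hco, hco, hco,
      ← Finset.sum_add_distrib, ← Finset.sum_add_distrib, ← Finset.sum_add_distrib]
    · refine Finset.sum_congr rfl fun T hT => ?_
      rw [if_pos (sub12 T hT)]
      by_cases a1 : ρ₁ ∈ T <;> by_cases a2 : ρ₂ ∈ T <;> simp [a1, a2]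
    · intro p; simp; tauto
  set S := ∑ F ∈ twoForests γ i j k l,
          (if (edgeGraph F).Reachable i k then (1 : ℝ) else -1) * prodWeight γ F with hS
  have dS : (A + Matrix.vecMulVec (vec i j) (vec k l)).det - A.det = S := by
    rw [hA, mixed_det E hE i j k l i hij h1E w hwr hw1, hS]
    refine Finset.sum_congr ?_ ?_
    · ext F
      simp only [Finset.mem_filter, Finset.mem_powerset, twoForests, Finset.mem_univ, true_and,
        ForestCond, hEdef]
    · intro F hF
      simp only [twoForests, Finset.mem_filter] at hF
      congr 1
      exact Finset.prod_congr rfl fun t ht => hwE t (hF.2.1 ht)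
  have dS' : (A + Matrix.vecMulVec (vec k l) (vec i j)).det - A.det = S := by
    rw [← dS, ← Matrix.det_transpose, Matrix.transpose_add, Matrix.transpose_vecMulVec, hA,
      gram_transpose]
  have key := det_two_update A (vec i j) (vec k l) (vec i j) (vec k l)
  rw [dS, dS', d0, d1, d2, d12] at key
  rw [crossDisc]
  linear_combination key
end

section
/- Let Γ be a connected weighted graph on {1,…,N} (N ≥ 3) whose black edges carry fixed positive weights and whose only red edges are the edge {1,2} with weight −x and the edge {1,3} with weight −y (the two red edges share vertex 1). Let L_{12,13} denote the submatrix of the Laplacian L(Γ) obtained by deleting rows 1 and 2 and columns 1 and 3 (this submatrix does not involve x or y). Then Δ = −(det L_{12,13})². -/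
open Finset
open scoped Classical

lemma det_two_upd {m : Type*} [Fintype m] [DecidableEq m] (A : Matrix m m ℝ) (i j : m) (hij : i ≠ j)
    (s t : ℝ) :
    (A + Matrix.single i i s + Matrix.single j j t).det =
      A.det + s * A.adjugate i i + t * A.adjugate j j +
        s * t * ((A.updateRow i (Pi.single i 1)).updateRow j (Pi.single j 1)).det := by
  have h1 : A + Matrix.single i i s + Matrix.single j j t =
      (A.updateRow i (A i + s • Pi.single i 1)).updateRow j (A j + t • Pi.single j 1) := by
    ext a b
    by_cases ha : a = j
    · subst ha
      simp [Matrix.single_apply, Pi.single_apply, hij, eq_comm]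
    · by_cases hb : a = i
      · subst hb
        simp [Matrix.single_apply, Pi.single_apply, hij, Matrix.updateRow_ne hij, eq_comm]
        intro h; exact absurd h.symm hij
      · simp [Matrix.single_apply, Matrix.updateRow_ne ha, Matrix.updateRow_ne hb, Ne.symm ha, Ne.symm hb]
  have h2 : ∀ v, (A.updateRow i v).updateRow j (A j) = A.updateRow i v := by
    intro v
    ext a b
    by_cases ha : a = j
    · subst ha
      simp [Matrix.updateRow_ne hij.symm]
    · simp [Matrix.updateRow_ne ha]
  have h3 : (A.updateRow i (A i)) = A := by simp
  rw [h1, Matrix.det_updateRow_add, Matrix.det_updateRow_smul, h2, Matrix.det_updateRow_add,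
    Matrix.det_updateRow_smul, h3, Matrix.updateRow_comm _ hij, Matrix.det_updateRow_add,
    Matrix.det_updateRow_smul, Matrix.updateRow_comm _ hij.symm, Matrix.updateRow_comm _ hij.symm,
    Matrix.adjugate_apply, Matrix.adjugate_apply, h3]
  ring

lemma jac_inv {m : Type*} [Fintype m] [DecidableEq m] (A : Matrix m m ℝ) (i j : m) (hij : i ≠ j)
    (hA : A.det ≠ 0) :
    ((A.updateRow i (Pi.single i 1)).updateRow j (Pi.single j 1)).det * A.det =
      A.adjugate i i * A.adjugate j j - A.adjugate i j * A.adjugate j i := by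
  have hu : IsUnit A.det := isUnit_iff_ne_zero.mpr hA
  have key := det_two_upd A i j hij 1 1
  let U : Matrix m (Fin 2) ℝ := Matrix.of fun a k => if a = ![i, j] k then 1 else 0
  let V : Matrix (Fin 2) m ℝ := Matrix.of fun k a => if a = ![i, j] k then 1 else 0
  have h1 : A + Matrix.single i i 1 + Matrix.single j j 1 = A + U * V := by
    rw [add_assoc]; congr 1
    ext a b
    simp [Matrix.mul_apply, Fin.sum_univ_two, U, V, Matrix.single_apply]
    grind
  have h2 : ∀ k l, (V * A⁻¹ * U) k l = A.det⁻¹ * A.adjugate (![i,j] k) (![i,j] l) := by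
    intro k l
    simp [Matrix.mul_apply, U, V, Matrix.inv_def]
  rw [h1, Matrix.det_add_mul _ _ hu, Matrix.det_fin_two] at key
  simp only [Matrix.add_apply, h2] at key
  simp at key
  field_simp at key
  linarith

lemma jac {m : Type*} [Fintype m] [DecidableEq m] (A : Matrix m m ℝ) (i j : m) (hij : i ≠ j) :
    ((A.updateRow i (Pi.single i 1)).updateRow j (Pi.single j 1)).det * A.det =
      A.adjugate i i * A.adjugate j j - A.adjugate i j * A.adjugate j i := by
  let B : ℝ → Matrix m m ℝ := fun t => A - t • 1
  have hB : Continuous B := by fun_prop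
  let F : ℝ → ℝ := fun t => (((B t).updateRow i (Pi.single i 1)).updateRow j (Pi.single j 1)).det * (B t).det
  let G : ℝ → ℝ := fun t => (B t).adjugate i i * (B t).adjugate j j - (B t).adjugate i j * (B t).adjugate j i
  have hF : Continuous F := by
    refine Continuous.mul (Continuous.matrix_det ?_) hB.matrix_det
    exact (hB.matrix_updateRow i continuous_const).matrix_updateRow j continuous_const
  have hadj : ∀ k l, Continuous fun t => (B t).adjugate k l := fun k l =>
    hB.matrix_adjugate.matrix_elem k l
  have hG : Continuous G := ((hadj i i).mul (hadj j j)).sub ((hadj i j).mul (hadj j i))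
  have hd : Dense ({t : ℝ | t ∈ A.charpoly.roots.toFinset}ᶜ) := by
    apply Set.Countable.dense_compl ℝ
    exact (Set.Finite.countable (Finset.finite_toSet _))
  have : F = G := by
    refine Continuous.ext_on hd hF hG ?_
    intro t ht
    refine jac_inv (B t) i j hij ?_
    intro h0
    apply ht
    simp only [Set.mem_ofPred_eq, Multiset.mem_toFinset]
    rw [Polynomial.mem_roots (Matrix.charpoly_monic A).ne_zero, Polynomial.IsRoot, Matrix.eval_charpoly]
    have : Matrix.scalar m t - A = -(B t) := by
      simp [B, Matrix.smul_one_eq_diagonal]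
    rw [this, Matrix.det_neg, h0, mul_zero]
  have := congrFun this 0
  simpa [F, G, B] using this
def GoodPar {m : ℕ} (f : Fin m → Fin (m + 1)) : Prop :=
  ∃ d : Fin (m + 1) → ℕ, ∀ i, d (f i) < d i.succ

noncomputable def parMat {m : ℕ} (f : Fin m → Fin (m + 1)) : Matrix (Fin m) (Fin m) ℝ :=
  Matrix.of fun i j => (if i = j then 1 else 0) - (if f i = j.succ then 1 else 0)

lemma parMat_good {m : ℕ} (f : Fin m → Fin (m + 1)) (h : GoodPar f) : (parMat f).det = 1 := by
  obtain ⟨d, hd⟩ := h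
  have hT : (parMat f).BlockTriangular (fun i : Fin m => OrderDual.toDual (d i.succ)) := by
    intro i j hij
    simp only [OrderDual.toDual_lt_toDual] at hij
    have h1 : i ≠ j := by rintro rfl; exact lt_irrefl _ hij
    have h2 : f i ≠ j.succ := by
      intro h
      have := hd i
      rw [h] at this
      omega
    simp [parMat, h1, h2]
  rw [hT.det]
  apply Finset.prod_eq_one
  intro a _
  have : (parMat f).toSquareBlock (fun i : Fin m => OrderDual.toDual (d i.succ)) a = 1 := by
    ext ⟨i, hi⟩ ⟨j, hj⟩
    have h2 : f i ≠ j.succ := by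
      intro h
      have := hd i
      rw [h] at this
      have e : d i.succ = d j.succ := OrderDual.toDual.injective (hi.trans hj.symm)
      omega
    simp [Matrix.toSquareBlock_def, parMat, h2, Matrix.one_apply]
  rw [this, Matrix.det_one]

lemma parMat_bad {m : ℕ} (f : Fin m → Fin (m + 1)) (h : ¬ GoodPar f) : (parMat f).det = 0 := by
  let g : Fin (m + 1) → Fin (m + 1) := Fin.cases 0 f
  have g0 : g 0 = 0 := rfl
  have gs : ∀ i, g i.succ = f i := fun i => rfl
  let R : Fin (m + 1) → Prop := fun v => ∃ k, g^[k] v = 0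
  have hstep : ∀ i : Fin m, R i.succ ↔ R (f i) := by
    intro i
    constructor
    · rintro ⟨k, hk⟩
      cases k with
      | zero => exact absurd hk (Fin.succ_ne_zero i)
      | succ k => exact ⟨k, by rw [← gs]; simpa using hk⟩
    · rintro ⟨k, hk⟩
      exact ⟨k + 1, by simpa [gs] using hk⟩
  by_cases hall : ∀ v, R v
  · exfalso
    apply h
    refine ⟨fun v => Nat.find (hall v), fun i => ?_⟩
    have hs := Nat.find_spec (hall i.succ)
    rcases hk : Nat.find (hall i.succ) with _ | k
    · rw [hk] at hs; exact absurd hs (Fin.succ_ne_zero i)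
    · rw [hk] at hs
      have : g^[k] (f i) = 0 := by rw [← gs]; simpa using hs
      have := Nat.find_min' (hall (f i)) this
      show Nat.find _ < Nat.find _
      omega
  · push Not at hall
    obtain ⟨v, hv⟩ := hall
    apply Matrix.exists_mulVec_eq_zero_iff.mp
    refine ⟨fun j => if R j.succ then 0 else 1, ?_, ?_⟩
    · intro h0
      have hv0 : v ≠ 0 := by rintro rfl; exact hv ⟨0, rfl⟩
      obtain ⟨j, rfl⟩ := Fin.exists_succ_eq.mpr hv0
      have := congrFun h0 j
      simp [hv] at this
    · ext i
      simp only [Matrix.mulVec, dotProduct, parMat, Matrix.of_apply, sub_mul, Finset.sum_sub_distrib, Pi.zero_apply]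
      simp only [ite_mul, one_mul, zero_mul, Finset.sum_ite_eq, Finset.mem_univ, if_true]
      by_cases h0 : f i = 0
      · have : R i.succ := (hstep i).mpr ⟨0, h0⟩
        rw [if_pos this]
        simp [h0, (Fin.succ_ne_zero _).symm]
      · obtain ⟨j, hj⟩ := Fin.exists_succ_eq.mpr h0
        have := hstep i
        rw [← hj] at this
        simp [← hj, this]

noncomputable def redLap {m : ℕ} (w : Fin (m + 1) → Fin (m + 1) → ℝ) : Matrix (Fin m) (Fin m) ℝ :=
  Matrix.of fun i j => ∑ k, w i.succ k * ((if i = j then 1 else 0) - (if k = j.succ then 1 else 0))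

lemma redLap_det {m : ℕ} (w : Fin (m + 1) → Fin (m + 1) → ℝ) :
    (redLap w).det = ∑ f ∈ univ.filter (fun f : Fin m → Fin (m + 1) => GoodPar f), ∏ i, w i.succ (f i) := by
  have h1 : redLap w = fun i => ∑ k, w i.succ k •
      (fun j : Fin m => ((if i = j then 1 else 0) - (if k = j.succ then 1 else 0) : ℝ)) := by
    ext i j
    simp [redLap, Finset.sum_apply]
  have h2 := (Matrix.detRowAlternating (n := Fin m) (R := ℝ)).toMultilinearMap.map_sum
    (fun (i : Fin m) (k : Fin (m + 1)) => w i.succ k •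
      (fun j : Fin m => ((if i = j then 1 else 0) - (if k = j.succ then 1 else 0) : ℝ)))
  have h3 : (redLap w).det = _ := (congrArg Matrix.det h1).trans h2
  rw [h3, Finset.sum_filter]
  apply Finset.sum_congr rfl
  intro f _
  rw [MultilinearMap.map_smul_univ]
  change _ • (parMat f).det = _
  split_ifs with h
  · rw [parMat_good f h]; simp
  · rw [parMat_bad f h]; simp

noncomputable def treeOf {m : ℕ} (f : Fin m → Fin (m + 1)) : Finset (Fin (m + 1) × Fin (m + 1)) :=
  univ.image fun i => redPair i.succ (f i)

lemma redPair_eq {N : ℕ} {a b c d : Fin N} (h : redPair a b = redPair c d) :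
    (a = c ∧ b = d) ∨ (a = d ∧ b = c) := by
  simp only [redPair, Prod.mk.injEq] at h
  grind

lemma redPair_comm {N : ℕ} (a b : Fin N) : redPair a b = redPair b a := by
  simp [redPair, min_comm, max_comm]

lemma good_inj {m : ℕ} {f : Fin m → Fin (m + 1)} (hf : GoodPar f) :
    Function.Injective fun i => redPair i.succ (f i) := by
  obtain ⟨d, hd⟩ := hf
  intro i j h
  rcases redPair_eq h with ⟨h1, _⟩ | ⟨h1, h2⟩
  · exact Fin.succ_injective _ h1
  · have a := hd i
    have b := hd j
    rw [← h1] at b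
    rw [h2] at a
    omega

lemma treeOf_card {m : ℕ} {f : Fin m → Fin (m + 1)} (hf : GoodPar f) : (treeOf f).card = m := by
  rw [treeOf, Finset.card_image_of_injective _ (good_inj hf)]; simp

lemma treeOf_prod {m : ℕ} {f : Fin m → Fin (m + 1)} (hf : GoodPar f)
    (w : Fin (m + 1) → Fin (m + 1) → ℝ) (hw : ∀ a b, w a b = w b a) :
    prodWeight w (treeOf f) = ∏ i, w i.succ (f i) := by
  rw [prodWeight, treeOf, Finset.prod_image (fun a _ b _ h => good_inj hf h)]
  apply Finset.prod_congr rfl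
  intro i _
  simp only [redPair]
  rcases le_total i.succ (f i) with h | h
  · simp [h]
  · simp [h, hw]

lemma treeOf_inj {m : ℕ} {f g : Fin m → Fin (m + 1)} (hf : GoodPar f)
    (h : treeOf f = treeOf g) : f = g := by
  obtain ⟨d, hd⟩ := hf
  have key : ∀ (k : ℕ) (i : Fin m), d i.succ = k → f i = g i := by
    intro k
    induction k using Nat.strong_induction_on with
    | _ k ih =>
      intro i hi
      have hm : redPair i.succ (f i) ∈ treeOf g := by
        rw [← h]; exact Finset.mem_image_of_mem _ (Finset.mem_univ i)
      obtain ⟨j, _, hj⟩ := Finset.mem_image.mp hm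
      rcases redPair_eq hj with ⟨h1, h2⟩ | ⟨h1, h2⟩
      · rw [← Fin.succ_injective _ h1, h2, Fin.succ_injective _ h1]
      · have a := hd i
        have b := hd j
        rw [← h1] at a
        rw [ih (d j.succ) (by omega) j rfl, h2] at b
        omega
  funext i
  exact key _ i rfl

lemma treeOf_lt {m : ℕ} {f : Fin m → Fin (m + 1)} (hf : GoodPar f) : ∀ p ∈ treeOf f, p.1 < p.2 := by
  obtain ⟨d, hd⟩ := hf
  intro p hp
  obtain ⟨i, _, rfl⟩ := Finset.mem_image.mp hp
  have : i.succ ≠ f i := by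
    intro h
    have := hd i
    rw [← h] at this
    omega
  simp [redPair, this.symm]

lemma mem_redPair_adj {N : ℕ} {T : Finset (Fin N × Fin N)} {a b : Fin N} (hab : a ≠ b)
    (h : redPair a b ∈ T) : (edgeGraph T).Adj a b := by
  simp only [edgeGraph, SimpleGraph.fromRel_adj]
  refine ⟨hab, ?_⟩
  rcases le_total a b with h1 | h1
  · left; simpa [redPair, h1] using h
  · right; simpa [redPair, h1] using h

lemma adj_mem_redPair {N : ℕ} {T : Finset (Fin N × Fin N)} (hT : ∀ p ∈ T, p.1 < p.2) {a b : Fin N}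
    (h : (edgeGraph T).Adj a b) : redPair a b ∈ T := by
  simp only [edgeGraph, SimpleGraph.fromRel_adj] at h
  rcases h.2 with h1 | h1
  · have := (hT _ h1).le
    simpa [redPair, this] using h1
  · have := (hT _ h1).le
    simp only at this
    simpa [redPair, this] using h1

lemma edge_card {N : ℕ} {T : Finset (Fin N × Fin N)} (hT : ∀ p ∈ T, p.1 < p.2) :
    Nat.card (edgeGraph T).edgeSet = T.card := by
  have : (edgeGraph T).edgeSet = ((T.image fun p => s(p.1, p.2) : Finset (Sym2 (Fin N))) : Set (Sym2 (Fin N))) := by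
    ext e
    induction e with
    | _ a b =>
      simp only [SimpleGraph.mem_edgeSet, Finset.coe_image, Set.mem_image, Finset.mem_coe, Sym2.eq_iff]
      constructor
      · intro h
        refine ⟨_, adj_mem_redPair hT h, ?_⟩
        simp only [redPair]
        rcases le_total a b with h1 | h1 <;> simp [h1]
      · rintro ⟨⟨c, d⟩, hp, h⟩
        have := hT _ hp
        simp only [edgeGraph, SimpleGraph.fromRel_adj]
        rcases h with ⟨rfl, rfl⟩ | ⟨rfl, rfl⟩
        · exact ⟨this.ne, Or.inl hp⟩
        · exact ⟨this.ne', Or.inr hp⟩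
  rw [this, Nat.card_coe_set_eq, Set.ncard_coe_finset, Finset.card_image_of_injOn]
  rintro ⟨a, b⟩ hp ⟨c, d⟩ hq h
  have h1 := hT _ hp
  have h2 := hT _ hq
  simp only [Sym2.eq_iff] at h h1 h2
  rcases h with ⟨rfl, rfl⟩ | ⟨rfl, rfl⟩
  · rfl
  · exact absurd h1 h2.asymm

lemma treeOf_isTree {m : ℕ} {f : Fin m → Fin (m + 1)} (hf : GoodPar f) :
    (edgeGraph (treeOf f)).IsTree := by
  rw [SimpleGraph.isTree_iff_connected_and_card, edge_card (treeOf_lt hf), treeOf_card hf]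
  refine ⟨?_, by simp⟩
  obtain ⟨d, hd⟩ := hf
  have key : ∀ (k : ℕ) (v : Fin (m + 1)), d v = k → (edgeGraph (treeOf f)).Reachable v 0 := by
    intro k
    induction k using Nat.strong_induction_on with
    | _ k ih =>
      intro v hv
      rcases Fin.eq_zero_or_eq_succ v with rfl | ⟨i, rfl⟩
      · exact SimpleGraph.Reachable.refl _
      · have hi := hd i
        have hne : i.succ ≠ f i := by
          intro h; rw [← h] at hi; omega
        have := mem_redPair_adj hne (Finset.mem_image_of_mem (fun i => redPair i.succ (f i)) (Finset.mem_univ i))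
        exact this.reachable.trans (ih _ (by omega) (f i) rfl)
  have : Nonempty (Fin (m + 1)) := ⟨0⟩
  exact ⟨fun u v => (key _ u rfl).trans (key _ v rfl).symm⟩

lemma treeOf_surj {m : ℕ} {T : Finset (Fin (m + 1) × Fin (m + 1))} (hT : ∀ p ∈ T, p.1 < p.2)
    (ht : (edgeGraph T).IsTree) : ∃ f, GoodPar f ∧ treeOf f = T := by
  have hc := ht.connected
  have : ∀ i : Fin m, ∃ v, (edgeGraph T).Adj i.succ v ∧ (edgeGraph T).dist v 0 < (edgeGraph T).dist i.succ 0 := by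
    intro i
    obtain ⟨p, hp⟩ := hc.exists_walk_length_eq_dist i.succ 0
    generalize hq : i.succ = u at p hp
    cases p with
    | nil => exact absurd hq (Fin.succ_ne_zero i)
    | cons h q =>
      refine ⟨_, h, ?_⟩
      have := SimpleGraph.dist_le q
      simp at hp
      omega
  choose f hf using this
  have hg : GoodPar f := ⟨fun v => (edgeGraph T).dist v 0, fun i => (hf i).2⟩
  refine ⟨f, hg, ?_⟩
  apply Finset.eq_of_subset_of_card_le
  · intro p hp
    obtain ⟨i, _, rfl⟩ := Finset.mem_image.mp hp
    exact adj_mem_redPair hT (hf i).1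
  · rw [treeOf_card hg]
    have := (SimpleGraph.isTree_iff_connected_and_card.mp ht).2
    rw [edge_card hT] at this
    simp at this
    omega

theorem matrix_tree_s7 {m : ℕ} (w : Fin (m + 1) → Fin (m + 1) → ℝ) (hw : ∀ a b, w a b = w b a) :
    (redLap w).det = ∑ T ∈ univ.filter (fun T : Finset (Fin (m + 1) × Fin (m + 1)) =>
      (∀ p ∈ T, p.1 < p.2) ∧ (edgeGraph T).IsTree), prodWeight w T := by
  rw [redLap_det]
  refine Finset.sum_bij (fun f _ => treeOf f) ?_ ?_ ?_ ?_
  · intro f hf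
    have hf := (Finset.mem_filter.mp hf).2
    exact Finset.mem_filter.mpr ⟨Finset.mem_univ _, treeOf_lt hf, treeOf_isTree hf⟩
  · intro f hf g _ h
    exact treeOf_inj (Finset.mem_filter.mp hf).2 h
  · intro T hT
    obtain ⟨_, h1, h2⟩ := Finset.mem_filter.mp hT
    obtain ⟨f, hf, h⟩ := treeOf_surj h1 h2
    exact ⟨f, Finset.mem_filter.mpr ⟨Finset.mem_univ _, hf⟩, h⟩
  · intro f hf
    exact (treeOf_prod (Finset.mem_filter.mp hf).2 w hw).symm

lemma redPair_of_lt {N : ℕ} {p : Fin N × Fin N} (h : p.1 < p.2) : redPair p.1 p.2 = p := by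
  simp [redPair, h.le]

/-- The black weights with extra weights `s`, `t` on the two red edges. -/
noncomputable def wst {n : ℕ} (γ : Fin (n + 3) → Fin (n + 3) → ℝ) (s t : ℝ) :
    Fin (n + 3) → Fin (n + 3) → ℝ := fun a b =>
  γ a b + (if redPair a b = redPair 0 1 then s else 0) + (if redPair a b = redPair 0 2 then t else 0)

lemma red_ne {n : ℕ} : redPair (0 : Fin (n + 3)) 1 ≠ redPair 0 2 := by
  intro h
  rcases redPair_eq h with ⟨_, h⟩ | ⟨h, _⟩
  · exact absurd (Fin.succ_injective _ h : (0 : Fin (n + 2)) = 1) (by simp)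
  · exact absurd h.symm (Fin.succ_ne_zero (1 : Fin (n + 2)))

lemma coeffA_eq {n : ℕ} (γ : Fin (n + 3) → Fin (n + 3) → ℝ) (b1 b2 : Bool) :
    coeffA γ 0 1 0 2 b1 b2 = ∑ T ∈ univ.filter (fun T : Finset (Fin (n + 3) × Fin (n + 3)) =>
      (∀ p ∈ T, p.1 < p.2) ∧ (edgeGraph T).IsTree),
      if (redPair 0 1 ∈ T ↔ b1 = true) ∧ (redPair 0 2 ∈ T ↔ b2 = true) then
        prodWeight γ (T \ {redPair 0 1, redPair 0 2}) else 0 := by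
  rw [coeffA, Finset.sum_filter]
  apply Finset.sum_subset
  · intro T hT
    simp only [spTrees, Finset.mem_filter, Finset.mem_univ, true_and] at hT ⊢
    refine ⟨fun p hp => ?_, hT.2⟩
    have := hT.1 hp
    simp only [blackE, Finset.mem_union, Finset.mem_filter, Finset.mem_univ, true_and,
      Finset.mem_insert, Finset.mem_singleton] at this
    rcases this with h | rfl | rfl
    · exact h.1
    · simp [redPair]
    · simpa [redPair] using (Fin.succ_pos (1 : Fin (n + 2)))
  · intro T hT hT'
    simp only [spTrees, Finset.mem_filter, Finset.mem_univ, true_and] at hT hT'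
    have hns : ¬ T ⊆ blackE γ ∪ {redPair 0 1, redPair 0 2} := fun h => hT' ⟨h, hT.2⟩
    obtain ⟨p, hp, hpn⟩ := Finset.not_subset.mp hns
    rw [Finset.mem_union, not_or] at hpn
    have h0 : γ p.1 p.2 = 0 := by
      by_contra hne
      exact hpn.1 (by simp [blackE, hne, hT.1 p hp])
    have : prodWeight γ (T \ {redPair 0 1, redPair 0 2}) = 0 :=
      Finset.prod_eq_zero (Finset.mem_sdiff.mpr ⟨hp, hpn.2⟩) h0
    simp [this]

lemma prod_wst {n : ℕ} (γ : Fin (n + 3) → Fin (n + 3) → ℝ)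
    (hred1 : γ 0 1 = 0) (hred2 : γ 0 2 = 0) (s t : ℝ)
    (T : Finset (Fin (n + 3) × Fin (n + 3))) (hT : ∀ p ∈ T, p.1 < p.2) :
    prodWeight (wst γ s t) T = prodWeight γ (T \ {redPair 0 1, redPair 0 2}) *
      ((if redPair 0 1 ∈ T then s else 1) * (if redPair 0 2 ∈ T then t else 1)) := by
  have hR : ∏ p ∈ T ∩ {redPair 0 1, redPair 0 2}, wst γ s t p.1 p.2 =
      (if redPair 0 1 ∈ T then s else 1) * (if redPair 0 2 ∈ T then t else 1) := by
    rw [Finset.inter_comm, ← Finset.prod_ite_mem, Finset.prod_pair red_ne]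
    have e1 : wst γ s t (redPair 0 1).1 (redPair 0 1).2 = s := by
      have h : redPair (redPair (0 : Fin (n + 3)) 1).1 (redPair (0 : Fin (n + 3)) 1).2 = redPair 0 1 :=
        redPair_of_lt (by simp [redPair])
      have h' : γ (redPair 0 1).1 (redPair 0 1).2 = 0 := by simpa [redPair] using hred1
      rw [wst, h, h', if_pos rfl, if_neg red_ne]; ring
    have e2 : wst γ s t (redPair 0 2).1 (redPair 0 2).2 = t := by
      have h : redPair (redPair (0 : Fin (n + 3)) 2).1 (redPair (0 : Fin (n + 3)) 2).2 = redPair 0 2 :=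
        redPair_of_lt (by simpa [redPair] using (Fin.succ_pos (1 : Fin (n + 2))))
      have h' : γ (redPair 0 2).1 (redPair 0 2).2 = 0 := by simpa [redPair] using hred2
      rw [wst, h, h', if_pos rfl, if_neg red_ne.symm]; ring
    rw [e1, e2]
  rw [prodWeight, ← Finset.prod_inter_mul_prod_sdiff T {redPair 0 1, redPair 0 2}, hR, mul_comm]
  congr 1
  apply Finset.prod_congr rfl
  intro p hp
  rw [Finset.mem_sdiff] at hp
  have h := redPair_of_lt (hT p hp.1)
  have hn := hp.2
  simp only [Finset.mem_insert, Finset.mem_singleton, not_or] at hn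
  rw [wst, h, if_neg hn.1, if_neg hn.2]; ring

lemma tree_split {n : ℕ} (γ : Fin (n + 3) → Fin (n + 3) → ℝ)
    (hsym : ∀ a b, γ a b = γ b a) (hred1 : γ 0 1 = 0) (hred2 : γ 0 2 = 0) (s t : ℝ) :
    (redLap (wst γ s t)).det = coeffA γ 0 1 0 2 false false + s * coeffA γ 0 1 0 2 true false +
      t * coeffA γ 0 1 0 2 false true + s * t * coeffA γ 0 1 0 2 true true := by
  rw [matrix_tree_s7 _ (fun a b => by simp only [wst, redPair_comm a b, hsym a b])]
  simp only [coeffA_eq, Finset.mul_sum, ← Finset.sum_add_distrib]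
  apply Finset.sum_congr rfl
  intro T hT
  rw [prod_wst γ hred1 hred2 s t T (Finset.mem_filter.mp hT).2.1]
  by_cases h1 : redPair 0 1 ∈ T <;> by_cases h2 : redPair 0 2 ∈ T <;> simp [h1, h2] <;> ring

lemma redLap_apply {m : ℕ} (w : Fin (m + 1) → Fin (m + 1) → ℝ) (i j : Fin m) :
    redLap w i j = (if i = j then ∑ k, w i.succ k else 0) - w i.succ j.succ := by
  simp only [redLap, Matrix.of_apply, mul_sub, Finset.sum_sub_distrib]
  congr 1
  · split_ifs <;> simp
  · simp

lemma red_iff1 {n : ℕ} (i : Fin (n + 2)) (k : Fin (n + 3)) :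
    redPair i.succ k = redPair 0 1 ↔ i = 0 ∧ k = 0 := by
  constructor
  · intro h
    rcases redPair_eq h with ⟨h1, _⟩ | ⟨h1, h2⟩
    · exact absurd h1 (Fin.succ_ne_zero i)
    · exact ⟨Fin.succ_injective _ h1, h2⟩
  · rintro ⟨rfl, rfl⟩
    exact redPair_comm _ _

lemma red_iff2 {n : ℕ} (i : Fin (n + 2)) (k : Fin (n + 3)) :
    redPair i.succ k = redPair 0 2 ↔ i = 1 ∧ k = 0 := by
  constructor
  · intro h
    rcases redPair_eq h with ⟨h1, _⟩ | ⟨h1, h2⟩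
    · exact absurd h1 (Fin.succ_ne_zero i)
    · exact ⟨Fin.succ_injective _ h1, h2⟩
  · rintro ⟨rfl, rfl⟩
    exact redPair_comm _ _

lemma redLap_wst {n : ℕ} (γ : Fin (n + 3) → Fin (n + 3) → ℝ) (s t : ℝ) :
    redLap (wst γ s t) = redLap γ + Matrix.single 0 0 s + Matrix.single 1 1 t := by
  ext i j
  simp only [Matrix.add_apply, redLap_apply, wst, red_iff1, red_iff2, Fin.succ_ne_zero, and_false,
    if_false, add_zero, Finset.sum_add_distrib, Matrix.single_apply]
  have e1 : ∑ k : Fin (n + 3), (if i = 0 ∧ k = 0 then s else 0) = if i = 0 then s else 0 := by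
    by_cases h : i = 0 <;> simp [h]
  have e2 : ∑ k : Fin (n + 3), (if i = 1 ∧ k = 0 then t else 0) = if i = 1 then t else 0 := by
    by_cases h : i = 1 <;> simp [h]
  rw [e1, e2]
  by_cases hij : i = j
  · subst hij
    simp only [if_true, and_self, @eq_comm _ i]
    ring
  · have a1 : ¬ (0 = i ∧ 0 = j) := fun h => hij (h.1.symm.trans h.2)
    have a2 : ¬ (1 = i ∧ 1 = j) := fun h => hij (h.1.symm.trans h.2)
    simp [hij, a1, a2]

/-- **Δ = −(det L_{12,13})² (red edges sharing a vertex).**  For a connected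
weighted graph on `n+3 ≥ 3` vertices whose red edges are `{1,2}` (weight `−x`)
and `{1,3}` (weight `−y`) (here `0,1,2` in `Fin (n+3)`), the discriminant
equals minus the square of the determinant of the submatrix of the Laplacian
obtained by deleting rows `1,2` and columns `1,3`. -/
theorem discriminant_eq_neg_square_minor_shared
    {n : ℕ} (γ : Fin (n + 3) → Fin (n + 3) → ℝ)
    (hsym : ∀ a b, γ a b = γ b a) (hdiag : ∀ a, γ a a = 0)
    (hpos : ∀ a b, 0 ≤ γ a b)
    (hred1 : γ 0 1 = 0) (hred2 : γ 0 2 = 0)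
    (hconn : (edgeGraph (blackE γ ∪ {redPair 0 1, redPair 0 2})).Connected)
    (x y : ℝ) :
    crossDisc γ 0 1 0 2 =
      -(((lapl (fun a b =>
            if (a = 0 ∧ b = 1) ∨ (a = 1 ∧ b = 0) then -x
            else if (a = 0 ∧ b = 2) ∨ (a = 2 ∧ b = 0) then -y
            else γ a b)).submatrix
          (fun r : Fin (n + 1) =>
            (⟨(r : ℕ) + 2, by have := r.isLt; omega⟩ : Fin (n + 3)))
          (fun c : Fin (n + 1) =>
            if (c : ℕ) = 0 then (⟨1, by omega⟩ : Fin (n + 3))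
            else (⟨(c : ℕ) + 2, by have := c.isLt; omega⟩ : Fin (n + 3)))).det) ^ 2 := by
  set A := redLap γ with hA
  have h01 : (0 : Fin (n + 2)) ≠ 1 := by simp
  have hp : ∀ s t : ℝ, coeffA γ 0 1 0 2 false false + s * coeffA γ 0 1 0 2 true false +
      t * coeffA γ 0 1 0 2 false true + s * t * coeffA γ 0 1 0 2 true true = _ := fun s t =>
    (tree_split γ hsym hred1 hred2 s t).symm.trans
      ((congrArg Matrix.det (redLap_wst γ s t)).trans (det_two_upd A 0 1 h01 s t))
  have p00 := hp 0 0
  have p10 := hp 1 0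
  have p01 := hp 0 1
  have p11 := hp 1 1
  have J := jac A 0 1 h01
  have hAs : A.transpose = A := by
    ext i j
    simp only [Matrix.transpose_apply, hA, redLap_apply, hsym j.succ i.succ]
    congr 1
    by_cases h : i = j
    · subst h; rfl
    · simp [h, Ne.symm h]
  have hadj : A.adjugate 0 1 = A.adjugate 1 0 := by
    have h := Matrix.adjugate_transpose A
    rw [hAs] at h
    exact (congrFun (congrFun h 1) 0)
  have hsub : (lapl (fun a b =>
            if (a = 0 ∧ b = 1) ∨ (a = 1 ∧ b = 0) then -x
            else if (a = 0 ∧ b = 2) ∨ (a = 2 ∧ b = 0) then -y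
            else γ a b)).submatrix
          (fun r : Fin (n + 1) =>
            (⟨(r : ℕ) + 2, by have := r.isLt; omega⟩ : Fin (n + 3)))
          (fun c : Fin (n + 1) =>
            if (c : ℕ) = 0 then (⟨1, by omega⟩ : Fin (n + 3))
            else (⟨(c : ℕ) + 2, by have := c.isLt; omega⟩ : Fin (n + 3))) =
      -(A.submatrix (Fin.succAbove 0) (Fin.succAbove 1)) := by
    ext r c
    have hr : (⟨(r : ℕ) + 2, by have := r.isLt; omega⟩ : Fin (n + 3)) = r.succ.succ := by
      ext; simp
    have r0 : r.succ.succ ≠ 0 := Fin.succ_ne_zero _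
    have r1 : r.succ.succ ≠ 1 := fun h => Fin.succ_ne_zero r (Fin.succ_injective _ h)
    simp only [Matrix.submatrix_apply, Matrix.neg_apply, hA, redLap_apply, hr, Fin.succAbove_zero]
    rcases Fin.eq_zero_or_eq_succ c with rfl | ⟨c, rfl⟩
    · have e : (⟨1, by omega⟩ : Fin (n + 3)) = 1 := rfl
      have e2 : (Fin.succAbove (1 : Fin (n + 2)) 0) = 0 := by simp
      have e3 : (0 : Fin (n + 2)).succ = 1 := rfl
      simp [e2, e3, e, lapl, r0, r1]
    · have e : (⟨(c.succ : ℕ) + 2, by have := c.isLt; simp⟩ : Fin (n + 3)) = c.succ.succ.succ := by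
        ext; simp
      have e2 : (Fin.succAbove (1 : Fin (n + 2)) c.succ) = c.succ.succ := by
        exact Fin.succ_succAbove_succ 0 c
      have c0 : c.succ.succ.succ ≠ 0 := Fin.succ_ne_zero _
      have c1 : c.succ.succ.succ ≠ 1 := fun h => Fin.succ_ne_zero _ (Fin.succ_injective _ h)
      have c2 : c.succ.succ.succ ≠ 2 := fun h =>
        Fin.succ_ne_zero _ (Fin.succ_injective _ (Fin.succ_injective _ h))
      rw [e2, if_neg (by simp), e]
      simp only [lapl, Matrix.of_apply]
      by_cases h : r = c.succ
      · subst h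
        have := Finset.sum_erase_add univ (fun k => γ c.succ.succ.succ k) (Finset.mem_univ c.succ.succ.succ)
        rw [hdiag] at this
        simp only [if_true, c0, c1, c2, false_and, or_false, if_false, hdiag, sub_zero, ← this, add_zero]
        rw [Finset.filter_ne']
      · have h' : r.succ.succ ≠ c.succ.succ.succ := fun h' =>
          h (Fin.succ_injective _ (Fin.succ_injective _ h'))
        have h'' : r.succ ≠ c.succ.succ := fun h' => h (Fin.succ_injective _ h')
        simp only [h', h'', if_false, r0, r1, c0, c1, false_and, and_false, or_false]
        ring
  rw [hsub, Matrix.det_neg, mul_pow, ← pow_mul, mul_comm _ 2, pow_mul]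
  have hminor : A.adjugate 1 0 ^ 2 = (A.submatrix (Fin.succAbove 0) (Fin.succAbove 1)).det ^ 2 := by
    rw [Matrix.adjugate_fin_succ_eq_det_submatrix, mul_pow, ← pow_mul, mul_comm _ 2, pow_mul]
    simp
  rw [← hminor]
  rw [hadj] at J
  have q10 : coeffA γ 0 1 0 2 true false = A.adjugate 0 0 := by linarith
  have q01 : coeffA γ 0 1 0 2 false true = A.adjugate 1 1 := by linarith
  have q00 : coeffA γ 0 1 0 2 false false = A.det := by linarith
  have q11 : coeffA γ 0 1 0 2 true true =
    ((A.updateRow 0 (Pi.single 0 1)).updateRow 1 (Pi.single 1 1)).det := by linarith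
  rw [crossDisc, q00, q01, q10, q11, J]
  simp
  ring
end

section
/- Let Γ be a connected weighted graph whose black edges carry positive weights and which has exactly two vertex-disjoint red edges, x = {i,j} and y = {k,l}, and let Δ be the discriminant of its crossing polynomial. If there exists a weight-preserving automorphism σ of Γ (a permutation of the vertices with γ_{σ(a)σ(b)} = γ_{ab} for all a,b) such that σ exchanges i and j while fixing k and l, then Δ = 0. -/
open Finset
open scoped Classical

namespace CrossAux

open SimpleGraph

variable {V : Type} [Fintype V] [DecidableEq V]
set_option linter.unusedSectionVars false

/-- Acyclic graphs with at most two components. -/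
def IsBi (G : SimpleGraph V) : Prop :=
  G.IsAcyclic ∧ ∀ a b c, G.Reachable a b ∨ G.Reachable b c ∨ G.Reachable a c

/-- weight of a graph -/
noncomputable def W (w : Sym2 V → ℝ) (G : SimpleGraph V) : ℝ :=
  ∏ e ∈ univ.filter (fun e => e ∈ G.edgeSet), w e

noncomputable def del (G : SimpleGraph V) (u v : V) : SimpleGraph V := G.deleteEdges {s(u, v)}

/-- indicator -/
noncomputable def ind (p : Prop) : ℝ := if p then 1 else 0

lemma reach_del (G : SimpleGraph V) (u v a b : V) (h : G.Reachable a b)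
    (ha : (del G u v).Reachable a u ∨ (del G u v).Reachable a v) :
    (del G u v).Reachable b u ∨ (del G u v).Reachable b v := by
  obtain ⟨p⟩ := h
  induction p with
  | nil => exact ha
  | @cons x y z hxy p ih =>
    apply ih
    by_cases he : s(x, y) = s(u, v)
    · rw [Sym2.eq_iff] at he
      rcases he with ⟨rfl, rfl⟩ | ⟨rfl, rfl⟩
      · exact Or.inr (Reachable.refl _)
      · exact Or.inl (Reachable.refl _)
    · have hadj : (del G u v).Adj y x := by
        simp only [del, deleteEdges_adj, Set.mem_singleton_iff]
        exact ⟨hxy.symm, by rwa [Sym2.eq_swap]⟩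
      exact ha.imp (hadj.reachable.trans) (hadj.reachable.trans)

lemma tree_del {T : SimpleGraph V} (hT : T.IsTree) {u v : V} (h : T.Adj u v) :
    IsBi (del T u v) ∧ ¬ (del T u v).Reachable u v := by
  have hnr : ¬ (del T u v).Reachable u v := by
    have := (isAcyclic_iff_forall_adj_isBridge.1 hT.isAcyclic) h
    rwa [isBridge_iff] at this
  refine ⟨⟨hT.isAcyclic.anti (deleteEdges_le _), ?_⟩, hnr⟩
  have key : ∀ a, (del T u v).Reachable a u ∨ (del T u v).Reachable a v := fun a =>
    reach_del T u v u a (hT.connected.preconnected u a) (Or.inl (Reachable.refl _))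
  intro a b c
  rcases key a with ha | ha <;> rcases key b with hb | hb <;> rcases key c with hc | hc
  · exact Or.inl (ha.trans hb.symm)
  · exact Or.inl (ha.trans hb.symm)
  · exact Or.inr (Or.inr (ha.trans hc.symm))
  · exact Or.inr (Or.inl (hb.trans hc.symm))
  · exact Or.inr (Or.inl (hb.trans hc.symm))
  · exact Or.inr (Or.inr (ha.trans hc.symm))
  · exact Or.inl (ha.trans hb.symm)
  · exact Or.inl (ha.trans hb.symm)

lemma bi_add {F : SimpleGraph V} (hF : IsBi F) {u v : V} (h : ¬ F.Reachable u v) :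
    (F ⊔ edge u v).IsTree := by
  have hne : u ≠ v := fun e => h (e ▸ Reachable.refl _)
  have hadj : (F ⊔ edge u v).Adj u v := by simp [edge_adj, hne]
  have hle : F ≤ F ⊔ edge u v := le_sup_left
  have key : ∀ a, (F ⊔ edge u v).Reachable a u := by
    intro a
    rcases hF.2 a u v with h1 | h1 | h1
    · exact h1.mono hle
    · exact absurd h1 h
    · exact (h1.mono hle).trans hadj.symm.reachable
  have : Nonempty V := ⟨u⟩
  exact ⟨⟨fun a b => (key a).trans (key b).symm⟩, hF.1.sup_edge_of_not_reachable h⟩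

lemma add_del {T : SimpleGraph V} {u v : V} (h : T.Adj u v) : del T u v ⊔ edge u v = T := by
  ext a b
  simp only [del, sup_adj, deleteEdges_adj, edge_adj, Set.mem_singleton_iff, Sym2.eq_iff]
  have := h.ne
  constructor
  · rintro (h1 | ⟨⟨rfl, rfl⟩ | ⟨rfl, rfl⟩, h2⟩)
    · exact h1.1
    · exact h
    · exact h.symm
  · intro h1
    have := h1.ne
    tauto

lemma del_add {F : SimpleGraph V} {u v : V} (h : ¬ F.Reachable u v) :
    del (F ⊔ edge u v) u v = F := by
  have h0 : ¬ F.Adj u v := fun e => h e.reachable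
  ext a b
  simp only [del, sup_adj, deleteEdges_adj, edge_adj, Set.mem_singleton_iff, Sym2.eq_iff]
  constructor
  · tauto
  · intro h1
    refine ⟨Or.inl h1, ?_⟩
    rintro (⟨rfl, rfl⟩ | ⟨rfl, rfl⟩)
    · exact h0 h1
    · exact h0 h1.symm

lemma W_del (w : Sym2 V → ℝ) {T : SimpleGraph V} {u v : V} (h : T.Adj u v) :
    W w T = w s(u, v) * W w (del T u v) := by
  unfold W
  rw [← Finset.mul_prod_erase _ _ (a := s(u, v)) (by simpa using h)]
  congr 2
  ext e
  simp [del, and_comm]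

lemma sum_bi (u v : V) (f : SimpleGraph V → ℝ) :
    ∑ F ∈ univ.filter (fun F : SimpleGraph V => IsBi F ∧ ¬ F.Reachable u v), f F
      = ∑ T ∈ univ.filter (fun T : SimpleGraph V => T.IsTree ∧ T.Adj u v), f (del T u v) := by
  refine Finset.sum_nbij' (fun F => F ⊔ edge u v) (fun T => del T u v) ?_ ?_ ?_ ?_ ?_
  · intro F hF
    simp only [mem_filter, mem_univ, true_and] at hF ⊢
    have hne : u ≠ v := fun e => hF.2 (e ▸ Reachable.refl _)
    exact ⟨bi_add hF.1 hF.2, by simp [edge_adj, hne]⟩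
  · intro T hT
    simp only [mem_filter, mem_univ, true_and] at hT ⊢
    exact tree_del hT.1 hT.2
  · intro F hF
    simp only [mem_filter, mem_univ, true_and] at hF
    exact del_add hF.2
  · intro T hT
    simp only [mem_filter, mem_univ, true_and] at hT
    exact add_del hT.2
  · intro F hF
    simp only [mem_filter, mem_univ, true_and] at hF
    simp only [del_add hF.2]

lemma path_lift {T : SimpleGraph V} (hT : T.IsTree) {u v j : V} (h : T.Adj u v)
    (hr : (del T u v).Reachable v j) : ∃ p : T.Walk v j, (Walk.cons h p).IsPath := by
  obtain ⟨p, hp⟩ := hr.exists_isPath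
  have hle : del T u v ≤ T := deleteEdges_le _
  refine ⟨p.mapLe hle, ?_⟩
  rw [Walk.cons_isPath_iff]
  refine ⟨?_, ?_⟩
  · exact hp.mapLe _
  · intro hu
    have hu' : u ∈ p.support := by
      simpa using hu
    exact (tree_del hT h).2 (p.takeUntil u hu').reachable.symm

lemma exists_unique_nbr {T : SimpleGraph V} (hT : T.IsTree) {u j : V} (huj : u ≠ j) :
    ∃! v, T.Adj u v ∧ (del T u v).Reachable v j := by
  obtain ⟨q, hq, huniq⟩ := hT.existsUnique_path u j
  cases q with
  | nil => exact absurd rfl huj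
  | @cons _ v _ h p =>
    refine ⟨v, ⟨h, ?_⟩, ?_⟩
    · rw [Walk.cons_isPath_iff] at hq
      refine ⟨p.toDeleteEdges {s(u, v)} ?_⟩
      intro e he hee
      rw [Set.mem_singleton_iff] at hee
      subst hee
      exact hq.2 (p.fst_mem_support_of_mem_edges he)
    · rintro v' ⟨h', hr⟩
      obtain ⟨p', hp'⟩ := path_lift hT h' hr
      have := huniq _ hp'
      injection this

lemma sum_nbr {T : SimpleGraph V} (hT : T.IsTree) (u j : V) :
    ∑ v, ind (T.Adj u v ∧ (del T u v).Reachable v j) = 1 - ind (j = u) := by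
  by_cases huj : u = j
  · subst huj
    simp only [ind, if_true, sub_self]
    refine Finset.sum_eq_zero fun v _ => if_neg ?_
    rintro ⟨h1, h2⟩
    exact (tree_del hT h1).2 h2.symm
  · obtain ⟨v, hv, hu⟩ := exists_unique_nbr hT huj
    rw [Finset.sum_eq_single v]
    · rw [ind, if_pos hv, ind, if_neg (Ne.symm huj), sub_zero]
    · intro b _ hb
      exact if_neg fun h => hb (hu b h)
    · simp

noncomputable def tau (w : Sym2 V → ℝ) : ℝ :=
  ∑ T ∈ univ.filter (fun T : SimpleGraph V => T.IsTree), W w T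

noncomputable def phi (w : Sym2 V → ℝ) (i j v : V) : ℝ :=
  ∑ F ∈ univ.filter (fun F : SimpleGraph V => IsBi F ∧ ¬ F.Reachable i j),
    W w F * ind (F.Reachable v i)

lemma ind_compl {F : SimpleGraph V} (hF : IsBi F) {i j : V} (h : ¬ F.Reachable i j) (v : V) :
    ind (F.Reachable v j) = 1 - ind (F.Reachable v i) := by
  unfold ind
  by_cases b1 : F.Reachable v j
  · have b2 : ¬ F.Reachable v i := fun b => h (b.symm.trans b1)
    simp [b1, b2]
  · have b2 : F.Reachable v i := by
      rcases hF.2 v i j with h' | h' | h'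
      · exact h'
      · exact absurd h' h
      · exact absurd h' b1
    simp [b1, b2]

lemma ind_symm (F : SimpleGraph V) (a b : V) : ind (F.Reachable a b) = ind (F.Reachable b a) := by
  have : F.Reachable a b ↔ F.Reachable b a := ⟨Reachable.symm, Reachable.symm⟩
  unfold ind
  simp [this]

lemma ind_id {F : SimpleGraph V} (hF : IsBi F) {i j u v : V} (h : ¬ F.Reachable u v) :
    ind (¬ F.Reachable i j) * (ind (F.Reachable u i) - ind (F.Reachable v i))
      = ind (F.Reachable v j) - ind (F.Reachable v i) := by
  by_cases a1 : F.Reachable i j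
  · have : F.Reachable v j ↔ F.Reachable v i := ⟨fun h => h.trans a1.symm, fun h => h.trans a1⟩
    rw [propext this, sub_self]
    simp [a1, ind]
  · rw [ind_compl hF a1 v, ind_symm F v i, ind_compl hF h i, ind_symm F u i]
    simp [ind, a1]

lemma phi_diff (w : Sym2 V → ℝ) (i j u v : V) :
    w s(u, v) * (phi w i j u - phi w i j v)
      = ∑ T ∈ univ.filter (fun T : SimpleGraph V => T.IsTree), W w T *
          (ind (T.Adj u v ∧ (del T u v).Reachable v j)
            - ind (T.Adj u v ∧ (del T u v).Reachable v i)) := by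
  have h1 : phi w i j u - phi w i j v =
      ∑ F ∈ univ.filter (fun F : SimpleGraph V => IsBi F ∧ ¬ F.Reachable u v),
        W w F * (ind (F.Reachable v j) - ind (F.Reachable v i)) := by
    unfold phi
    rw [← Finset.sum_sub_distrib, Finset.sum_filter, Finset.sum_filter]
    refine Finset.sum_congr rfl fun F _ => ?_
    by_cases hb : IsBi F
    · by_cases huv : F.Reachable u v
      · have : F.Reachable u i ↔ F.Reachable v i :=
          ⟨fun h => huv.symm.trans h, fun h => huv.trans h⟩
        simp [this, huv]
      · have := ind_id hb (i := i) (j := j) huv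
        rw [if_pos (show _ ∧ _ from ⟨hb, huv⟩), ← this]
        by_cases hij : F.Reachable i j
        · simp [hij, ind]
        · simp [hij, hb, ind, mul_sub]
    · simp [hb]
  rw [h1, sum_bi, Finset.mul_sum, ← Finset.filter_filter, Finset.sum_filter]
  refine Finset.sum_congr rfl fun T hT => ?_
  by_cases h : T.Adj u v
  · simp [h, W_del w h, mul_assoc]
  · simp [h, ind]

lemma kirchhoff (w : Sym2 V → ℝ) (i j u : V) :
    ∑ v, w s(u, v) * (phi w i j u - phi w i j v) = tau w * (ind (i = u) - ind (j = u)) := by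
  simp_rw [phi_diff]
  rw [Finset.sum_comm, tau, Finset.sum_mul]
  refine Finset.sum_congr rfl fun T hT => ?_
  simp only [mem_filter, mem_univ, true_and] at hT
  rw [← Finset.mul_sum, Finset.sum_sub_distrib, sum_nbr hT, sum_nbr hT]
  ring

lemma phi_j (w : Sym2 V → ℝ) (i j : V) : phi w i j j = 0 := by
  unfold phi
  refine Finset.sum_eq_zero fun F hF => ?_
  simp only [mem_filter, mem_univ, true_and] at hF
  rw [ind, if_neg (fun h => hF.2 h.symm), mul_zero]

lemma phi_i (w : Sym2 V → ℝ) (i j : V) : phi w i j i =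
    ∑ T ∈ univ.filter (fun T : SimpleGraph V => T.IsTree ∧ T.Adj i j), W w (del T i j) := by
  rw [← sum_bi]
  unfold phi
  refine Finset.sum_congr rfl fun F hF => ?_
  rw [ind, if_pos (Reachable.refl _), mul_one]

lemma green (w : Sym2 V → ℝ) (f g : V → ℝ) :
    ∑ u, f u * ∑ v, w s(u, v) * (g u - g v) = ∑ u, g u * ∑ v, w s(u, v) * (f u - f v) := by
  have key : ∀ f g : V → ℝ, ∑ u, f u * ∑ v, w s(u, v) * (g u - g v)
      = ∑ u, ∑ v, w s(u, v) * (f u * g u) - ∑ u, ∑ v, w s(u, v) * (f u * g v) := by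
    intro f g
    rw [← Finset.sum_sub_distrib]
    refine Finset.sum_congr rfl fun u _ => ?_
    rw [Finset.mul_sum, ← Finset.sum_sub_distrib]
    exact Finset.sum_congr rfl fun v _ => by ring
  rw [key, key]
  congr 1
  · exact Finset.sum_congr rfl fun u _ => Finset.sum_congr rfl fun v _ => by ring
  · rw [Finset.sum_comm]
    refine Finset.sum_congr rfl fun u _ => Finset.sum_congr rfl fun v _ => ?_
    rw [Sym2.eq_swap]; ring

lemma sum_tau (w w' : Sym2 V → ℝ) (i j : V)
    (h : ∀ u v, w s(u, v) * (phi w' i j u - phi w' i j v)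
      = w' s(u, v) * (phi w' i j u - phi w' i j v)) :
    tau w' * phi w i j i = tau w * phi w' i j i := by
  have h1 := green w (phi w i j) (phi w' i j)
  simp_rw [h, kirchhoff] at h1
  have key : ∀ (f : V → ℝ) (c : ℝ),
      ∑ u, f u * (c * (ind (i = u) - ind (j = u))) = c * (f i - f j) := by
    intro f c
    have : ∀ u, f u * (c * (ind (i = u) - ind (j = u)))
        = (if i = u then c * f u else 0) - (if j = u then c * f u else 0) := by
      intro u
      unfold ind
      split_ifs <;> ring
    simp_rw [this]
    rw [Finset.sum_sub_distrib]
    simp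
    ring
  rw [key, key, phi_j, phi_j, sub_zero, sub_zero] at h1
  exact h1

lemma W_comap (w : Sym2 V → ℝ) (σ : Equiv.Perm V)
    (hw : ∀ a b, w s(σ a, σ b) = w s(a, b)) (G : SimpleGraph V) :
    W w (G.comap σ) = W w G := by
  unfold W
  refine Finset.prod_nbij' (Sym2.map σ) (Sym2.map σ.symm) ?_ ?_ ?_ ?_ ?_
  · intro e
    induction e with | _ a b => simp
  · intro e
    induction e with | _ a b => simp
  · intro e
    induction e with | _ a b => simp
  · intro e
    induction e with | _ a b => simp
  · intro e
    induction e with | _ a b => simp [hw]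

lemma reach_comap (σ : Equiv.Perm V) (G : SimpleGraph V) (a b : V) :
    (G.comap σ).Reachable a b ↔ G.Reachable (σ a) (σ b) :=
  (Iso.reachable_iff (φ := Iso.comap σ G) (u := a) (v := b)).symm

lemma bi_comap (σ : Equiv.Perm V) (G : SimpleGraph V) : IsBi (G.comap σ) ↔ IsBi G := by
  unfold IsBi
  rw [Iso.isAcyclic_iff (Iso.comap σ G)]
  simp_rw [reach_comap]
  refine and_congr_right fun _ => ⟨fun h a b c => ?_, fun h a b c => h _ _ _⟩
  simpa using h (σ.symm a) (σ.symm b) (σ.symm c)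

lemma phi_kl (w : Sym2 V → ℝ) (σ : Equiv.Perm V)
    (hw : ∀ a b, w s(σ a, σ b) = w s(a, b)) (i j k l : V)
    (hswap : (σ i = j ∧ σ j = i ∧ σ k = k ∧ σ l = l) ∨
             (σ k = l ∧ σ l = k ∧ σ i = i ∧ σ j = j)) :
    phi w i j k = phi w i j l := by
  have h0 : phi w i j k - phi w i j l = ∑ F : SimpleGraph V,
      if IsBi F ∧ ¬ F.Reachable i j then
        W w F * (ind (F.Reachable k i) - ind (F.Reachable l i)) else 0 := by
    unfold phi
    rw [← Finset.sum_sub_distrib, Finset.sum_filter]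
    exact Finset.sum_congr rfl fun F _ => by split_ifs <;> ring
  have h1 : phi w i j k - phi w i j l = -(phi w i j k - phi w i j l) := by
    rw [h0, ← Finset.sum_neg_distrib]
    refine ((Equiv.simpleGraph σ.symm).sum_comp _).symm.trans ?_
    refine Finset.sum_congr rfl fun F _ => ?_
    have hE : (Equiv.simpleGraph σ.symm) F = F.comap σ := by
      ext a b; simp [Equiv.simpleGraph]
    simp only [hE, bi_comap, reach_comap, W_comap w σ hw]
    rcases hswap with ⟨a1, a2, a3, a4⟩ | ⟨a1, a2, a3, a4⟩
    · simp only [a1, a2, a3, a4]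
      have hs : F.Reachable j i ↔ F.Reachable i j := ⟨Reachable.symm, Reachable.symm⟩
      by_cases hF : IsBi F ∧ ¬ F.Reachable i j
      · rw [if_pos hF, if_pos (by rwa [hs]), ind_compl hF.1 hF.2, ind_compl hF.1 hF.2]
        ring
      · rw [if_neg hF, if_neg (by rwa [hs]), neg_zero]
    · simp only [a1, a2, a3, a4]
      split_ifs <;> ring
  linarith

end CrossAux

namespace CrossAux

open SimpleGraph

section
variable {V : Type} [Fintype V] [DecidableEq V]
set_option linter.unusedSectionVars false

/-- product of the weights of the edges other than `ij` and `kl` -/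
noncomputable def P (w : Sym2 V → ℝ) (i j k l : V) (G : SimpleGraph V) : ℝ :=
  ∏ e ∈ univ.filter (fun e => e ∈ G.edgeSet ∧ e ≠ s(i, j) ∧ e ≠ s(k, l)), w e

noncomputable def C (w : Sym2 V → ℝ) (i j k l : V) (b1 b2 : Bool) : ℝ :=
  ∑ T ∈ univ.filter (fun T : SimpleGraph V => T.IsTree),
    if (T.Adj i j ↔ b1 = true) ∧ (T.Adj k l ↔ b2 = true) then P w i j k l T else 0

lemma W_zero (w : Sym2 V → ℝ) {u v : V} {G : SimpleGraph V} (h : G.Adj u v)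
    (h0 : w s(u, v) = 0) : W w G = 0 := by
  rw [W_del w h, h0, zero_mul]

lemma W_P (w : Sym2 V → ℝ) {i j k l : V} {G : SimpleGraph V} (h1 : ¬ G.Adj i j)
    (h2 : ¬ G.Adj k l) : W w G = P w i j k l G := by
  unfold W P
  refine Finset.prod_congr ?_ fun _ _ => rfl
  ext e
  simp only [mem_filter, mem_univ, true_and]
  refine ⟨fun h => ⟨h, ?_, ?_⟩, fun h => h.1⟩
  · rintro rfl; exact h1 h
  · rintro rfl; exact h2 h

lemma P_del1 (w : Sym2 V → ℝ) (i j k l : V) (G : SimpleGraph V) :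
    P w i j k l (del G i j) = P w i j k l G := by
  unfold P
  refine Finset.prod_congr ?_ fun _ _ => rfl
  ext e
  simp only [mem_filter, mem_univ, true_and, del, edgeSet_deleteEdges, Set.mem_sdiff,
    Set.mem_singleton_iff]
  tauto

lemma P_del2 (w : Sym2 V → ℝ) (i j k l : V) (G : SimpleGraph V) :
    P w i j k l (del G k l) = P w i j k l G := by
  unfold P
  refine Finset.prod_congr ?_ fun _ _ => rfl
  ext e
  simp only [mem_filter, mem_univ, true_and, del, edgeSet_deleteEdges, Set.mem_sdiff,
    Set.mem_singleton_iff]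
  tauto

lemma del_adj (G : SimpleGraph V) (u v a b : V) :
    (del G u v).Adj a b ↔ G.Adj a b ∧ s(a, b) ≠ s(u, v) := by
  simp [del]

lemma W_cases (w : Sym2 V → ℝ) {i j k l : V} {G : SimpleGraph V} (h1 : ¬ G.Adj i j) :
    W w G = if G.Adj k l then w s(k, l) * P w i j k l G else P w i j k l G := by
  split_ifs with h
  · rw [W_del w h, W_P w (i := i) (j := j) (k := k) (l := l), P_del2]
    · rw [del_adj]; tauto
    · rw [del_adj]; tauto
  · exact W_P w h1 h

lemma tau_C (w : Sym2 V → ℝ) (i j k l : V) (h0 : w s(i, j) = 0) :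
    tau w = C w i j k l false false + w s(k, l) * C w i j k l false true := by
  unfold tau C
  rw [Finset.mul_sum, ← Finset.sum_add_distrib]
  refine Finset.sum_congr rfl fun T _ => ?_
  by_cases h1 : T.Adj i j
  · rw [W_zero w h1 h0]; simp [h1]
  · rw [W_cases w (k := k) (l := l) h1]
    by_cases h2 : T.Adj k l <;> simp [h1, h2]

lemma phi_C (w : Sym2 V → ℝ) (i j k l : V) (hne : s(k, l) ≠ s(i, j)) :
    phi w i j i = C w i j k l true false + w s(k, l) * C w i j k l true true := by
  rw [phi_i]
  unfold C
  rw [Finset.mul_sum, ← Finset.sum_add_distrib, ← Finset.filter_filter, Finset.sum_filter]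
  refine Finset.sum_congr rfl fun T _ => ?_
  by_cases h1 : T.Adj i j
  · rw [if_pos h1, W_cases w (i := i) (j := j) (k := k) (l := l) (by simp [del_adj]), P_del1]
    by_cases h2 : T.Adj k l <;> simp [h1, h2, del_adj, hne]
  · simp [h1]

lemma P_congr (w w' : Sym2 V → ℝ) (i j k l : V) (h : ∀ e, e ≠ s(k, l) → w e = w' e)
    (G : SimpleGraph V) : P w i j k l G = P w' i j k l G := by
  unfold P
  refine Finset.prod_congr rfl fun e he => h e ?_
  simp only [mem_filter] at he
  exact he.2.2.2

lemma C_congr (w w' : Sym2 V → ℝ) (i j k l : V) (h : ∀ e, e ≠ s(k, l) → w e = w' e)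
    (b1 b2 : Bool) : C w i j k l b1 b2 = C w' i j k l b1 b2 := by
  unfold C
  simp_rw [P_congr w w' i j k l h]

lemma disc_zero (w : Sym2 V → ℝ) (i j k l : V) (σ : Equiv.Perm V)
    (hw : ∀ a b, w s(σ a, σ b) = w s(a, b)) (hne : s(k, l) ≠ s(i, j))
    (h1 : w s(i, j) = 0) (h2 : w s(k, l) = 0)
    (hswap : (σ i = j ∧ σ j = i ∧ σ k = k ∧ σ l = l) ∨
             (σ k = l ∧ σ l = k ∧ σ i = i ∧ σ j = j)) :
    C w i j k l true true * C w i j k l false false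
      - C w i j k l false true * C w i j k l true false = 0 := by
  set w' : Sym2 V → ℝ := fun e => w e + if e = s(k, l) then 1 else 0 with hw'def
  have hinv : ∀ a b, s(σ a, σ b) = s(k, l) ↔ s(a, b) = s(k, l) := by
    intro a b
    have hk : s(k, l) = Sym2.map σ s(k, l) := by
      rw [Sym2.map_mk]
      rcases hswap with ⟨a1, a2, a3, a4⟩ | ⟨a1, a2, a3, a4⟩
      · rw [a3, a4]
      · rw [a1, a2, Sym2.eq_swap]
    rw [← Sym2.map_mk]
    constructor
    · intro h
      rw [hk] at h
      exact Sym2.map.injective σ.injective h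
    · intro h
      rw [h]; exact hk.symm
  have hw' : ∀ a b, w' s(σ a, σ b) = w' s(a, b) := by
    intro a b
    simp only [hw'def, hw, hinv]
  have hkl := phi_kl w' σ hw' i j k l hswap
  have hcon : ∀ e, e ≠ s(k, l) → w' e = w e := by
    intro e he
    simp [hw'def, he]
  have key := sum_tau w w' i j (by
    intro u v
    by_cases he : s(u, v) = s(k, l)
    · rw [Sym2.eq_iff] at he
      rcases he with ⟨rfl, rfl⟩ | ⟨rfl, rfl⟩ <;> simp [hkl]
    · rw [hcon _ he])
  have hw1 : w' s(k, l) = 1 := by simp [hw'def, h2]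
  rw [tau_C w i j k l h1, phi_C w i j k l hne,
    tau_C w' i j k l (by rw [hcon _ hne.symm, h1]), phi_C w' i j k l hne, h2, hw1] at key
  simp only [C_congr w' w i j k l hcon] at key
  linarith

end

variable {N : ℕ}

/-- The set of ordered pairs of a graph. -/
noncomputable def toT (G : SimpleGraph (Fin N)) : Finset (Fin N × Fin N) :=
  univ.filter fun p => p.1 < p.2 ∧ G.Adj p.1 p.2

lemma mem_toT (G : SimpleGraph (Fin N)) (p : Fin N × Fin N) :
    p ∈ toT G ↔ p.1 < p.2 ∧ G.Adj p.1 p.2 := by simp [toT]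

lemma edgeGraph_toT (G : SimpleGraph (Fin N)) : edgeGraph (toT G) = G := by
  ext a b
  simp only [edgeGraph, fromRel_adj, mem_toT]
  constructor
  · rintro ⟨_, h | h⟩
    · exact h.2
    · exact h.2.symm
  · intro h
    refine ⟨h.ne, ?_⟩
    rcases lt_or_gt_of_ne h.ne with h1 | h1
    · exact Or.inl ⟨h1, h⟩
    · exact Or.inr ⟨h1, h.symm⟩

lemma toT_edgeGraph (T : Finset (Fin N × Fin N)) (hT : ∀ p ∈ T, p.1 < p.2) :
    toT (edgeGraph T) = T := by
  ext ⟨a, b⟩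
  simp only [mem_toT, edgeGraph, fromRel_adj]
  constructor
  · rintro ⟨h, _, h1 | h1⟩
    · exact h1
    · exact absurd (hT _ h1) (not_lt.2 h.le)
  · intro h
    have := hT _ h
    exact ⟨this, this.ne, Or.inl h⟩

lemma redPair_mem (G : SimpleGraph (Fin N)) (i j : Fin N) (hij : i ≠ j) :
    redPair i j ∈ toT G ↔ G.Adj i j := by
  rw [mem_toT]
  rcases lt_or_gt_of_ne hij with h | h
  · simp [redPair, min_eq_left h.le, max_eq_right h.le, h]
  · simp [redPair, min_eq_right h.le, max_eq_left h.le, h, G.adj_comm]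

lemma redPair_lt (i j : Fin N) (hij : i ≠ j) : (redPair i j).1 < (redPair i j).2 := by
  simpa [redPair] using hij.symm

lemma eq_redPair (p : Fin N × Fin N) (hp : p.1 < p.2) (i j : Fin N) :
    p = redPair i j ↔ s(p.1, p.2) = s(i, j) := by
  obtain ⟨a, b⟩ := p
  simp only [redPair, Prod.mk.injEq, Sym2.eq_iff] at hp ⊢
  rcases le_total i j with h | h
  · rw [min_eq_left h, max_eq_right h]
    refine ⟨Or.inl, ?_⟩
    rintro (h1 | ⟨rfl, rfl⟩)
    · exact h1
    · exact absurd hp (not_lt.2 h)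
  · rw [min_eq_right h, max_eq_left h]
    refine ⟨Or.inr, ?_⟩
    rintro (⟨rfl, rfl⟩ | h1)
    · exact absurd hp (not_lt.2 h)
    · exact h1

lemma prod_P (γ : Fin N → Fin N → ℝ) (w : Sym2 (Fin N) → ℝ) (hγ : ∀ a b, w s(a, b) = γ a b)
    (i j k l : Fin N) (G : SimpleGraph (Fin N)) :
    prodWeight γ (toT G \ {redPair i j, redPair k l}) = P w i j k l G := by
  unfold prodWeight P
  refine Finset.prod_nbij (fun p => s(p.1, p.2)) ?_ ?_ ?_ ?_
  · intro p hp
    simp only [mem_sdiff, mem_toT, mem_insert, mem_singleton, not_or] at hp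
    obtain ⟨⟨h1, h2⟩, h3, h4⟩ := hp
    simp only [mem_filter, mem_univ, true_and]
    rw [eq_redPair p h1] at h3 h4
    exact ⟨h2, h3, h4⟩
  · rintro ⟨a, b⟩ hp ⟨c, d⟩ hq h
    simp only [coe_sdiff, Set.mem_sdiff, mem_coe, mem_toT] at hp hq
    have h1 := hp.1.1
    have h2 := hq.1.1
    simp only [Sym2.eq_iff] at h h1 h2
    rcases h with ⟨rfl, rfl⟩ | ⟨rfl, rfl⟩
    · rfl
    · exact absurd h1 (not_lt.2 h2.le)
  · intro e he
    induction e with | _ a b =>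
    simp only [coe_filter, mem_univ, true_and, Set.mem_ofPred_eq, mem_edgeSet] at he
    obtain ⟨h1, h2, h3⟩ := he
    rcases lt_or_gt_of_ne h1.ne with h | h
    · refine ⟨(a, b), ?_, rfl⟩
      simp only [mem_coe, mem_sdiff, mem_toT, mem_insert, mem_singleton, not_or]
      refine ⟨⟨h, h1⟩, ?_⟩
      rw [eq_redPair _ h, eq_redPair _ h]
      exact ⟨h2, h3⟩
    · refine ⟨(b, a), ?_, Sym2.eq_swap⟩
      simp only [mem_coe, mem_sdiff, mem_toT, mem_insert, mem_singleton, not_or]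
      refine ⟨⟨h, h1.symm⟩, ?_⟩
      rw [eq_redPair _ h, eq_redPair _ h]
      simp only [Sym2.eq_swap (a := b)]
      exact ⟨h2, h3⟩
  · intro p _
    exact (hγ _ _).symm

lemma coeffA_eq (γ : Fin N → Fin N → ℝ) (w : Sym2 (Fin N) → ℝ) (hγ : ∀ a b, w s(a, b) = γ a b)
    (i j k l : Fin N) (hij : i ≠ j) (hkl : k ≠ l) (b1 b2 : Bool) :
    coeffA γ i j k l b1 b2 = C w i j k l b1 b2 := by
  have hlt : ∀ T : Finset (Fin N × Fin N), T ⊆ blackE γ ∪ {redPair i j, redPair k l} →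
      ∀ p ∈ T, p.1 < p.2 := by
    intro T hT p hp
    have := hT hp
    simp only [blackE, mem_union, mem_filter, mem_univ, true_and, mem_insert,
      mem_singleton] at this
    rcases this with h | rfl | rfl
    · exact h.1
    · exact redPair_lt i j hij
    · exact redPair_lt k l hkl
  have h1 : coeffA γ i j k l b1 b2 = ∑ G ∈ univ.filter (fun G : SimpleGraph (Fin N) =>
      (toT G ⊆ blackE γ ∪ {redPair i j, redPair k l} ∧ G.IsTree) ∧
        (G.Adj i j ↔ b1 = true) ∧ (G.Adj k l ↔ b2 = true)), P w i j k l G := by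
    unfold coeffA spTrees
    refine Finset.sum_nbij' edgeGraph toT ?_ ?_ ?_ ?_ ?_
    · intro T hT
      simp only [mem_filter, mem_univ, true_and] at hT ⊢
      have h := toT_edgeGraph T (hlt T hT.1.1)
      rw [h, ← redPair_mem _ i j hij, ← redPair_mem _ k l hkl, h]
      exact hT
    · intro G hG
      simp only [mem_filter, mem_univ, true_and] at hG ⊢
      rw [edgeGraph_toT, redPair_mem _ i j hij, redPair_mem _ k l hkl]
      exact hG
    · intro T hT
      simp only [mem_filter, mem_univ, true_and] at hT
      exact toT_edgeGraph T (hlt T hT.1.1)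
    · intro G _
      exact edgeGraph_toT G
    · intro T hT
      simp only [mem_filter, mem_univ, true_and] at hT
      rw [← prod_P γ w hγ, toT_edgeGraph T (hlt T hT.1.1)]
  rw [h1]
  unfold C
  rw [← Finset.sum_filter, Finset.filter_filter]
  refine Finset.sum_subset ?_ ?_
  · intro G hG
    simp only [mem_filter, mem_univ, true_and] at hG ⊢
    exact ⟨hG.1.2, hG.2⟩
  · intro G hG hG'
    simp only [mem_filter, mem_univ, true_and] at hG hG'
    have hns : ¬ toT G ⊆ blackE γ ∪ {redPair i j, redPair k l} := fun h =>
      hG' ⟨⟨h, hG.1⟩, hG.2⟩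
    obtain ⟨p, hp, hp'⟩ := Finset.not_subset.1 hns
    rw [← prod_P γ w hγ, prodWeight]
    rw [mem_union, not_or] at hp'
    refine Finset.prod_eq_zero (i := p) (mem_sdiff.2 ⟨hp, hp'.2⟩) ?_
    by_contra h0
    apply hp'.1
    rw [mem_toT] at hp
    simp only [blackE, mem_filter, mem_univ, true_and]
    exact ⟨hp.1, h0⟩

end CrossAux

/-- **Automorphisms force a vanishing discriminant.**  If a connected weighted
graph with positive black weights has two vertex-disjoint red edges `{i,j}` and
`{k,l}`, and a weight-preserving automorphism `σ` exchanges `i` and `j` while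
fixing `k` and `l` (or vice versa), then the discriminant of its crossing
polynomial vanishes. -/
theorem automorphism_implies_discriminant_zero
    {N : ℕ} (γ : Fin N → Fin N → ℝ)
    (hsym : ∀ a b, γ a b = γ b a) (hdiag : ∀ a, γ a a = 0)
    (hpos : ∀ a b, 0 ≤ γ a b)
    (i j k l : Fin N) (hij : i ≠ j) (hkl : k ≠ l)
    (hdisjoint : Disjoint ({i, j} : Finset (Fin N)) ({k, l} : Finset (Fin N)))
    (hred1 : γ i j = 0) (hred2 : γ k l = 0)
    (hconn : (edgeGraph (blackE γ ∪ {redPair i j, redPair k l})).Connected)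
    (σ : Equiv.Perm (Fin N))
    (hw : ∀ a b, γ (σ a) (σ b) = γ a b)
    (hswap : (σ i = j ∧ σ j = i ∧ σ k = k ∧ σ l = l) ∨
             (σ k = l ∧ σ l = k ∧ σ i = i ∧ σ j = j)) :
    crossDisc γ i j k l = 0 := by
  have hne : s(k, l) ≠ s(i, j) := by
    intro h
    have hk : k ∈ ({i, j} : Finset (Fin N)) := by
      rw [Sym2.eq_iff] at h
      rcases h with ⟨h, _⟩ | ⟨h, _⟩ <;> simp [h]
    exact Finset.disjoint_left.1 hdisjoint hk (by simp)
  have hγ : ∀ a b, (Sym2.lift ⟨γ, hsym⟩ : Sym2 (Fin N) → ℝ) s(a, b) = γ a b := fun a b => rfl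
  unfold crossDisc
  simp only [CrossAux.coeffA_eq γ (Sym2.lift ⟨γ, hsym⟩) hγ i j k l hij hkl]
  exact CrossAux.disc_zero _ i j k l σ (fun a b => by rw [hγ, hγ, hw]) hne
    (by rw [hγ, hred1]) (by rw [hγ, hred2]) hswap
end
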